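/- arXiv:2010.01293 — 8 statements merged into one kernel-verified Lean document; each statement's English description precedes it below -/
import Mathlib

section
/- There exists a unique real number c* in the feasible domain F_d such that R(c*) = c*; moreover this fixed point satisfies 0.4402 < c* < 0.4403. -/
/-- The unimodal map `u_c(x) = 1 - ((x - c)/(1 - c))^2`. -/
noncomputable def u (c x : ℝ) : ℝ := 1 - ((x - c) / (1 - c)) ^ 2

/-- `uIter c k = u_c^k(0)`, the `k`-th iterate of `u_c` at `0`. -/
noncomputable def uIter (c : ℝ) (k : ℕ) : ℝ := (u c)^[k] 0

/-- Period-tripling scaling function `S₁(c) = u_c³(0)`. -/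
noncomputable def S1 (c : ℝ) : ℝ := uIter c 3
/-- Period-tripling scaling function `S₂(c) = u_c⁴(0) − u_c(0)`. -/
noncomputable def S2 (c : ℝ) : ℝ := uIter c 4 - uIter c 1
/-- Period-tripling scaling function `S₃(c) = 1 − u_c²(0)`. -/
noncomputable def S3 (c : ℝ) : ℝ := 1 - uIter c 2
/-- Gap function `G_l(c) = u_c(0) − u_c³(0)`. -/
noncomputable def Gl (c : ℝ) : ℝ := uIter c 1 - uIter c 3
/-- Gap function `G_r(c) = u_c²(0) − u_c⁴(0)`. -/
noncomputable def Gr (c : ℝ) : ℝ := uIter c 2 - uIter c 4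
/-- The period-tripling renormalization map `R(c) = (u_c⁴(0) − c)/S₂(c)`. -/
noncomputable def Rmap (c : ℝ) : ℝ := (uIter c 4 - c) / S2 c
/-- The feasible domain `F_d`. -/
def Fd : Set ℝ :=
  {c | c ∈ Set.Ioo (0 : ℝ) (1 / 2) ∧ 0 < S1 c ∧ 0 < S2 c ∧ 0 < S3 c ∧ 0 < Gl c ∧ 0 < Gr c}


noncomputable def wF (t : ℝ) : ℝ := t ^ 2 + t ^ 3 - 1

/-- `y ↦ 1 - (1+t) y^2`, the conjugated map, iterated from `-t`. -/
noncomputable def yy (t y : ℝ) : ℝ := 1 - (1 + t) * y ^ 2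

noncomputable def aF (t : ℝ) : ℝ := 2 - (1 + t) * wF t ^ 2
noncomputable def bF (t : ℝ) : ℝ := 2 * t - (1 + t) ^ 2 * wF t ^ 2 * aF t
noncomputable def HF (t : ℝ) : ℝ := (1 + t) ^ 2 * wF t * aF t * bF t

lemma u_conj (t y : ℝ) (ht : 0 < t) :
    u (t / (1 + t)) ((t + y) / (1 + t)) = (t + yy t y) / (1 + t) := by
  have h : (1 + t) ≠ 0 := by positivity
  have h1 : 1 - t / (1 + t) = 1 / (1 + t) := by field_simp; ring
  have h2 : (t + y) / (1 + t) - t / (1 + t) = y / (1 + t) := by field_simp; ring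
  have h3 : y / (1 + t) / (1 / (1 + t)) = y := by field_simp
  unfold u
  rw [h1, h2, h3]
  unfold yy
  field_simp
  ring

lemma iters (t : ℝ) (ht : 0 < t) :
    uIter (t / (1 + t)) 1 = (t + yy t (-t)) / (1 + t) ∧
    uIter (t / (1 + t)) 2 = (t + yy t (yy t (-t))) / (1 + t) ∧
    uIter (t / (1 + t)) 3 = (t + yy t (yy t (yy t (-t)))) / (1 + t) ∧
    uIter (t / (1 + t)) 4 = (t + yy t (yy t (yy t (yy t (-t))))) / (1 + t) := by
  have h0 : (0 : ℝ) = (t + -t) / (1 + t) := by simp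
  have e : ∀ k, uIter (t / (1 + t)) (k + 1) = u (t / (1 + t)) (uIter (t / (1 + t)) k) := by
    intro k
    unfold uIter
    rw [Function.iterate_succ_apply']
  have i0 : uIter (t / (1 + t)) 0 = (t + -t) / (1 + t) := by
    rw [← h0]; rfl
  have i1 := e 0
  rw [i0, u_conj t _ ht] at i1
  have i2 := e 1
  rw [i1, u_conj t _ ht] at i2
  have i3 := e 2
  rw [i2, u_conj t _ ht] at i3
  have i4 := e 3
  rw [i3, u_conj t _ ht] at i4
  exact ⟨i1, i2, i3, i4⟩

lemma fd_iff (t : ℝ) (ht : 0 < t) (y1 y2 y3 y4 : ℝ) (h1 : y1 = yy t (-t)) (h2 : y2 = yy t y1)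
    (h3 : y3 = yy t y2) (h4 : y4 = yy t y3) :
    (t / (1 + t) ∈ Fd ∧ Rmap (t / (1 + t)) = t / (1 + t)) ↔
      (t < 1 ∧ -t < y3 ∧ y1 < y4 ∧ y2 < 1 ∧ y3 < y1 ∧ y4 < y2 ∧ y4 = -t * y1) := by
  have hs : 0 < 1 + t := by positivity
  obtain ⟨i1, i2, i3, i4⟩ := iters t ht
  rw [← h1] at i1 i2 i3 i4
  rw [← h2] at i2 i3 i4
  rw [← h3] at i3 i4
  rw [← h4] at i4
  have e1 : (0 < t / (1 + t) ∧ t / (1 + t) < 1 / 2) ↔ t < 1 := by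
    rw [div_lt_div_iff₀ hs two_pos]
    constructor
    · rintro ⟨_, h⟩; linarith
    · intro h; exact ⟨by positivity, by linarith⟩
  have e2 : 0 < S1 (t / (1 + t)) ↔ -t < y3 := by
    unfold S1; rw [i3, div_pos_iff_of_pos_right hs]
    constructor <;> intro h <;> linarith
  have e3' : S2 (t / (1 + t)) = (y4 - y1) / (1 + t) := by
    unfold S2; rw [i4, i1]; ring
  have e3 : 0 < S2 (t / (1 + t)) ↔ y1 < y4 := by
    rw [e3', div_pos_iff_of_pos_right hs, sub_pos]
  have e4 : 0 < S3 (t / (1 + t)) ↔ y2 < 1 := by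
    unfold S3; rw [i2, sub_pos, div_lt_one hs]
    constructor <;> intro h <;> linarith
  have e5 : 0 < Gl (t / (1 + t)) ↔ y3 < y1 := by
    unfold Gl; rw [i1, i3, sub_pos, div_lt_div_iff_of_pos_right hs]
    constructor <;> intro h <;> linarith
  have e6 : 0 < Gr (t / (1 + t)) ↔ y4 < y2 := by
    unfold Gr; rw [i2, i4, sub_pos, div_lt_div_iff_of_pos_right hs]
    constructor <;> intro h <;> linarith
  have e7 : y1 < y4 → (Rmap (t / (1 + t)) = t / (1 + t) ↔ y4 = -t * y1) := by
    intro h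
    have hp : 0 < y4 - y1 := by linarith
    have : Rmap (t / (1 + t)) = y4 / (y4 - y1) := by
      unfold Rmap; rw [e3', i4]; field_simp; ring
    rw [this, div_eq_div_iff hp.ne' hs.ne']
    constructor <;> intro h <;> linarith
  constructor
  · rintro ⟨⟨p1, p2, p3, p4, p5, p6⟩, p7⟩
    exact ⟨e1.1 p1, e2.1 p2, e3.1 p3, e4.1 p4, e5.1 p5, e6.1 p6, (e7 (e3.1 p3)).1 p7⟩
  · rintro ⟨p1, p2, p3, p4, p5, p6, p7⟩
    exact ⟨⟨e1.2 p1, e2.2 p2, e3.2 p3, e4.2 p4, e5.2 p5, e6.2 p6⟩, (e7 p3).2 p7⟩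

lemma hasDeriv_HF (t : ℝ) : HasDerivAt HF
    ((2 * (1 + t) * wF t + (1 + t) ^ 2 * (2 * t + 3 * t ^ 2)) * aF t * bF t
      + (1 + t) ^ 2 * wF t * (-(wF t ^ 2 + (1 + t) * (2 * wF t * (2 * t + 3 * t ^ 2)))) * bF t
      + (1 + t) ^ 2 * wF t * aF t *
        (2 - ((2 * (1 + t) * wF t ^ 2 + (1 + t) ^ 2 * (2 * wF t * (2 * t + 3 * t ^ 2))) * aF t
          + (1 + t) ^ 2 * wF t ^ 2 *
            (-(wF t ^ 2 + (1 + t) * (2 * wF t * (2 * t + 3 * t ^ 2))))))) t := by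
  have hid := hasDerivAt_id t
  have hs : HasDerivAt (fun x : ℝ => 1 + x) 1 t := by simpa using hid.const_add 1
  have hw : HasDerivAt wF (2 * t + 3 * t ^ 2) t := by
    have := ((hasDerivAt_pow 2 t).add (hasDerivAt_pow 3 t)).sub_const 1
    refine (this.congr_deriv ?_)
    norm_num
  have ha : HasDerivAt aF (-(wF t ^ 2 + (1 + t) * (2 * wF t * (2 * t + 3 * t ^ 2)))) t := by
    refine ((hs.mul (hw.pow 2)).const_sub 2).congr_deriv ?_
    norm_num
  have hb := (hid.const_mul 2).sub (((hs.pow 2).mul (hw.pow 2)).mul ha)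
  have hH := (((hs.pow 2).mul hw).mul ha).mul hb
  refine hH.congr_deriv ?_
  simp [bF, Pi.pow_apply, Pi.mul_apply]
  ring

lemma deriv_HF_pos (t : ℝ) (h1 : 3 / 4 ≤ t) (h2 : t ≤ 81 / 100) : 0 < deriv HF t := by
  rw [(hasDeriv_HF t).deriv]
  have w1 : -(2/100) ≤ wF t := by unfold wF; nlinarith [mul_nonneg (sub_nonneg.2 h1) (sub_nonneg.2 h1)]
  have w2 : wF t ≤ 19 / 100 := by
    have a1 : t ^ 2 ≤ (81/100) ^ 2 := by gcongr
    have a2 : t ^ 3 ≤ (81/100) ^ 3 := by gcongr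
    unfold wF; norm_num at a1 a2; linarith
  have d1 : 3 ≤ 2 * t + 3 * t ^ 2 := by nlinarith
  have d2 : 2 * t + 3 * t ^ 2 ≤ 36/10 := by nlinarith
  have ws0 : 0 ≤ wF t ^ 2 := sq_nonneg _
  have ws : wF t ^ 2 ≤ 361/10000 := by nlinarith
  have s1 : 3 ≤ (1 + t) ^ 2 := by nlinarith
  have s2 : (1 + t) ^ 2 ≤ 33/10 := by nlinarith
  have a1 : 193/100 ≤ aF t := by unfold aF; nlinarith
  have a2 : aF t ≤ 2 := by unfold aF; nlinarith
  have q0 : 0 ≤ (1 + t) ^ 2 * wF t ^ 2 := by positivity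
  have q1 : (1 + t) ^ 2 * wF t ^ 2 ≤ 12/100 := by nlinarith
  have b1 : 125/100 ≤ bF t := by unfold bF; nlinarith
  have b2 : bF t ≤ 162/100 := by unfold bF; nlinarith
  generalize wF t = w at *
  generalize aF t = a at *
  generalize bF t = b at *
  generalize hd : 2 * t + 3 * t ^ 2 = d at *
  clear hd
  generalize hS : (1 + t) ^ 2 = S at *
  have wa : |w| ≤ 19/100 := abs_le.2 ⟨by linarith, w2⟩
  have wd1 : -(8/100) ≤ w * d := by nlinarith only [w1, d1, d2]
  have wd2 : w * d ≤ 69/100 := by nlinarith only [w2, d1, d2]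
  have sw1 : -(7/100) ≤ S * w := by nlinarith only [w1, s1, s2]
  have sw2 : S * w ≤ 63/100 := by nlinarith only [w2, s1, s2]
  have swd1 : -(27/100) ≤ S * (w * d) := by nlinarith only [wd1, s1, s2]
  have swd2 : S * (w * d) ≤ 228/100 := by nlinarith only [wd2, s1, s2]
  have ap : |-(w ^ 2 + (1 + t) * (2 * w * d))| ≤ 26/10 := by
    have k1 : -(15/100) ≤ (1 + t) * (w * d) := by nlinarith only [wd1, h1, h2]
    have k2 : (1 + t) * (w * d) ≤ 125/100 := by nlinarith only [wd2, h1, h2]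
    rw [abs_le]; constructor <;> linarith
  have sa : |S * w| ≤ 63/100 := abs_le.2 ⟨by linarith, sw2⟩
  generalize -(w ^ 2 + (1 + t) * (2 * w * d)) = a' at *
  obtain ⟨ap1, ap2⟩ := abs_le.1 ap
  have tw0 : 0 ≤ (1 + t) * w ^ 2 := by positivity
  have tw1 : (1 + t) * w ^ 2 ≤ 7/100 := by nlinarith only [ws0, ws, h1, h2]
  have qa : |S * w ^ 2 * a'| ≤ 12/100 * (26/10) := by
    rw [abs_mul, abs_of_nonneg q0]
    gcongr
  obtain ⟨qa1, qa2⟩ := abs_le.1 qa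
  have m1 : -(60/100) ≤ 2 * (1 + t) * w ^ 2 + S * (2 * w * d) := by linarith
  have m2 : 2 * (1 + t) * w ^ 2 + S * (2 * w * d) ≤ 470/100 := by linarith
  generalize 2 * (1 + t) * w ^ 2 + S * (2 * w * d) = m at *
  have ma1 : -(120/100) ≤ m * a := by nlinarith only [m1, a1, a2]
  have ma2 : m * a ≤ 940/100 := by nlinarith only [m2, a1, a2]
  have bp : |2 - (m * a + S * w ^ 2 * a')| ≤ 8 := by
    rw [abs_le]; constructor <;> linarith
  generalize 2 - (m * a + S * w ^ 2 * a') = b' at *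
  have k3 : -(4/100) ≤ (1 + t) * w := by nlinarith only [w1, h1, h2]
  have k4 : 3 * 3 ≤ S * d := by gcongr
  have T1 : 88/10 ≤ 2 * (1 + t) * w + S * d := by linarith
  have T2 : 88/10 * (193/100) ≤ (2 * (1 + t) * w + S * d) * a := by gcongr
  have T3 : 88/10 * (193/100) * (125/100) ≤ (2 * (1 + t) * w + S * d) * a * b := by gcongr
  have U : |S * w * a' * b| ≤ 63/100 * (26/10) * (162/100) := by
    rw [abs_mul, abs_mul, abs_of_pos (by linarith : 0 < b)]
    gcongr
  have V : |S * w * a * b'| ≤ 63/100 * 2 * 8 := by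
    rw [abs_mul, abs_mul, abs_of_pos (by linarith : 0 < a)]
    gcongr
  have := (abs_le.1 U).1
  have := (abs_le.1 V).1
  linarith

lemma HF_cont : Continuous HF :=
  continuous_iff_continuousAt.2 fun t => (hasDeriv_HF t).continuousAt

lemma HF_mono : StrictMonoOn HF (Set.Icc (3/4) (81/100)) := by
  apply strictMonoOn_of_deriv_pos (convex_Icc _ _) HF_cont.continuousOn
  intro t ht
  rw [interior_Icc] at ht
  exact deriv_HF_pos t ht.1.le ht.2.le

lemma HF_lo : HF (4402/5598) < 1 := by
  norm_num [HF, aF, bF, wF]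

lemma HF_hi : 1 < HF (4403/5597) := by
  norm_num [HF, aF, bF, wF]

/-- Algebraic identity: `y₄ + t y₁ = (1+t) w (H - 1)`. -/
lemma key_id (t : ℝ) : yy t (yy t (yy t (yy t (-t)))) - (-t * yy t (-t))
    = (1 + t) * wF t * (HF t - 1) := by
  unfold HF bF aF wF yy
  ring

lemma y1_eq (t : ℝ) : yy t (-t) = -wF t := by
  unfold yy wF; ring

lemma feas_imp (t : ℝ) (ht : 0 < t) (h : t / (1 + t) ∈ Fd ∧ Rmap (t / (1 + t)) = t / (1 + t)) :
    3 / 4 ≤ t ∧ t ≤ 81 / 100 ∧ HF t = 1 := by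
  rw [fd_iff t ht _ _ _ _ rfl rfl rfl rfl] at h
  obtain ⟨h1, h2, h3, h4, h5, h6, h7⟩ := h
  have hk := key_id t
  rw [h7, sub_self] at hk
  rw [h7] at h3 h6
  rw [y1_eq] at *
  have hw : 0 < wF t := by
    by_contra hcon
    push Not at hcon
    nlinarith
  have hH : HF t = 1 := by
    have : (1 + t) * wF t ≠ 0 := by positivity
    have := (mul_eq_zero.1 hk.symm).resolve_left this
    linarith
  have ht1 : 3 / 4 ≤ t := by
    by_contra hcon
    push Not at hcon
    have a1 : t ^ 2 ≤ (3/4) ^ 2 := by gcongr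
    have a2 : t ^ 3 ≤ (3/4) ^ 3 := by gcongr
    unfold wF at hw
    norm_num at a1 a2
    linarith
  refine ⟨ht1, ?_, hH⟩
  by_contra hcon
  push Not at hcon
  -- y₂ > t
  set y2 := yy t (-wF t) with hy2
  have hy2p : 0 < y2 := by nlinarith [mul_pos ht hw]
  have hsq : t ^ 2 < y2 ^ 2 := by
    have hh : (1 + t) * t ^ 2 < (1 + t) * y2 ^ 2 := by
      have : yy t y2 = 1 - (1 + t) * y2 ^ 2 := rfl
      rw [this] at h5
      unfold wF at h5
      nlinarith
    exact lt_of_mul_lt_mul_left hh (by positivity)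
  have hty : t < y2 := lt_of_pow_lt_pow_left₀ 2 hy2p.le hsq
  have ha : aF t = 1 + y2 := by rw [hy2]; unfold aF yy; ring
  have hp : (1 + t) * wF t ^ 2 = 1 - y2 := by rw [hy2]; unfold yy; ring
  have hb : bF t = 2 * t - (1 + t) * (1 - y2 ^ 2) := by
    have : bF t = 2 * t - (1 + t) * ((1 + t) * wF t ^ 2) * aF t := by unfold bF; ring
    rw [this, ha, hp]; ring
  have hb1 : 99 / 100 ≤ bF t := by
    rw [hb]; nlinarith
  have ha1 : 181 / 100 ≤ aF t := by rw [ha]; linarith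
  have hw1 : 187 / 1000 ≤ wF t := by
    have a1 : (81/100) ^ 2 ≤ t ^ 2 := by gcongr
    have a2 : (81/100) ^ 3 ≤ t ^ 3 := by gcongr
    unfold wF; norm_num at a1 a2; linarith
  have : (1 + 81/100) ^ 2 * (187/1000) * (181/100) * (99/100) ≤ HF t := by
    unfold HF; gcongr
  rw [hH] at this
  norm_num at this

lemma loc (t : ℝ) (h1 : 3 / 4 ≤ t) (h2 : t ≤ 81 / 100) (h : HF t = 1) :
    4402/5598 < t ∧ t < 4403/5597 := by
  constructor
  · rw [← HF_mono.lt_iff_lt (by constructor <;> norm_num) ⟨h1, h2⟩, h]; exact HF_lo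
  · rw [← HF_mono.lt_iff_lt ⟨h1, h2⟩ (by constructor <;> norm_num), h]; exact HF_hi

lemma feas_of (t : ℝ) (h1 : 4402/5598 < t) (h2 : t < 4403/5597) (h : HF t = 1) :
    t / (1 + t) ∈ Fd ∧ Rmap (t / (1 + t)) = t / (1 + t) := by
  have ht : 0 < t := by linarith
  rw [fd_iff t ht _ _ _ _ rfl rfl rfl rfl]
  have hk := key_id t
  rw [h, sub_self, mul_zero, sub_eq_zero] at hk
  rw [hk, y1_eq]
  have w1 : 10/100 ≤ wF t := by
    have a1 : (4402/5598) ^ 2 ≤ t ^ 2 := by gcongr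
    have a2 : (4402/5598) ^ 3 ≤ t ^ 3 := by gcongr
    unfold wF; norm_num at a1 a2; linarith
  have w2 : wF t ≤ 11/100 := by
    have a1 : t ^ 2 ≤ (4403/5597) ^ 2 := by gcongr
    have a2 : t ^ 3 ≤ (4403/5597) ^ 3 := by gcongr
    unfold wF; norm_num at a1 a2; linarith
  have t1 : 78/100 ≤ t := by linarith
  have t2 : t ≤ 79/100 := by linarith
  generalize wF t = w at *
  have y21 : 97/100 ≤ yy t (-w) := by unfold yy; nlinarith
  have y22 : yy t (-w) < 1 := by unfold yy; nlinarith
  generalize yy t (-w) = y at *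
  have ysq : y ^ 2 < 1 := by nlinarith
  have y31 : -t < yy t y := by unfold yy; nlinarith
  have y32 : yy t y < -w := by unfold yy; nlinarith
  refine ⟨by linarith, y31, by nlinarith, y22, y32, by nlinarith, rfl⟩

lemma c_form (c : ℝ) (h : c ∈ Fd) : 0 < c / (1 - c) ∧ c = (c / (1 - c)) / (1 + c / (1 - c)) := by
  obtain ⟨⟨h0, h1⟩, _⟩ := h
  have : 0 < 1 - c := by linarith
  refine ⟨by positivity, ?_⟩
  field_simp
  ring

lemma c_imp (c : ℝ) (h : c ∈ Fd) (hR : Rmap c = c) :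
    ∃ t, c = t / (1 + t) ∧ 3 / 4 ≤ t ∧ t ≤ 81 / 100 ∧ HF t = 1 := by
  obtain ⟨h0, h1⟩ := c_form c h
  generalize c / (1 - c) = t at *
  subst h1
  exact ⟨t, rfl, feas_imp t h0 ⟨h, hR⟩⟩

/-- There is a unique fixed point of the period-tripling renormalization map `R`
in the feasible domain `F_d`, and it lies in `(0.4402, 0.4403)`. -/
theorem stmt_0 :
    (∃! c : ℝ, c ∈ Fd ∧ Rmap c = c) ∧
    ∀ c : ℝ, c ∈ Fd → Rmap c = c → 0.4402 < c ∧ c < 0.4403 := by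
  constructor
  · obtain ⟨t, _, hH⟩ := intermediate_value_Icc (by norm_num : (4402/5598 : ℝ) ≤ 4403/5597)
      HF_cont.continuousOn ⟨HF_lo.le, HF_hi.le⟩
    rename_i hm
    have hm1 : 3 / 4 ≤ t := by have := hm.1; linarith
    have hm2 : t ≤ 81 / 100 := by have := hm.2; linarith
    obtain ⟨l1, l2⟩ := loc t hm1 hm2 hH
    refine ⟨t / (1 + t), feas_of t l1 l2 hH, ?_⟩
    rintro c ⟨hc, hR⟩
    obtain ⟨s, rfl, s1, s2, hs⟩ := c_imp c hc hR
    rw [HF_mono.injOn ⟨s1, s2⟩ ⟨hm1, hm2⟩ (hs.trans hH.symm)]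
  · intro c hc hR
    obtain ⟨t, rfl, t1, t2, ht⟩ := c_imp c hc hR
    obtain ⟨l1, l2⟩ := loc t t1 t2 ht
    have hs : 0 < 1 + t := by linarith
    rw [lt_div_iff₀ hs, div_lt_iff₀ hs]
    constructor <;> norm_num <;> linarith
end

section
/- If c ∈ F_d satisfies R(c) = c, then S₃(c) = S₂(c)², that is, 1 − u_c²(0) = (u_c⁴(0) − u_c(0))². (The vertical scaling ratio of the period-tripling renormalization fixed point is the square of the horizontal one.) -/
/-- At a fixed point of the period-tripling renormalization, the vertical scaling
ratio is the square of the horizontal one: `S₃(c) = S₂(c)²`. -/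
theorem stmt_2 (c : ℝ) (hc : c ∈ Fd) (hfix : Rmap c = c) :
    S3 c = (S2 c) ^ 2 ∧ 1 - uIter c 2 = (uIter c 4 - uIter c 1) ^ 2 := by
  obtain ⟨⟨h0, h1⟩, -, hS2, -⟩ := hc
  have hne : (1 - c) ≠ 0 := by linarith
  have h2 : uIter c 2 = 1 - ((uIter c 1 - c) / (1 - c)) ^ 2 := by
    simp [uIter, u]
  have hR : uIter c 4 - c = c * S2 c := by
    have h := hfix
    unfold Rmap at h
    rwa [div_eq_iff hS2.ne'] at h
  have hd : (uIter c 1 - c) / (1 - c) = -S2 c := by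
    rw [div_eq_iff hne]
    have hs : S2 c = uIter c 4 - uIter c 1 := rfl
    linarith
  have key : 1 - uIter c 2 = (S2 c) ^ 2 := by
    rw [h2, hd]
    ring
  exact ⟨key, key⟩
end

section
/- The feasible domain F_d is a nonempty open subset of ℝ, and every c ∈ F_d satisfies 0.398 < c < 0.457. -/
lemma uIter_cont (c : ℝ) (hc : 1 - c ≠ 0) (k : ℕ) : ContinuousAt (fun c => uIter c k) c := by
  induction k with
  | zero => simp only [uIter, Function.iterate_zero, id]; exact continuousAt_const
  | succ n ih =>
    simp only [uIter, Function.iterate_succ_apply'] at ih ⊢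
    unfold u at ih ⊢
    exact continuousAt_const.sub (((ih.sub continuousAt_id).div
      (continuousAt_const.sub continuousAt_id) hc).pow 2)

lemma fd_open : IsOpen Fd := by
  rw [isOpen_iff_mem_nhds]
  rintro c ⟨hc, h1, h2, h3, h4, h5⟩
  have hne : 1 - c ≠ 0 := by have := hc.2; intro h; linarith
  have k := uIter_cont c hne
  have e1 : ContinuousAt S1 c := k 3
  have e2 : ContinuousAt S2 c := (k 4).sub (k 1)
  have e3 : ContinuousAt S3 c := continuousAt_const.sub (k 2)
  have e4 : ContinuousAt Gl c := (k 1).sub (k 3)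
  have e5 : ContinuousAt Gr c := (k 2).sub (k 4)
  filter_upwards [Ioo_mem_nhds hc.1 hc.2, e1.eventually (lt_mem_nhds h1),
    e2.eventually (lt_mem_nhds h2), e3.eventually (lt_mem_nhds h3),
    e4.eventually (lt_mem_nhds h4), e5.eventually (lt_mem_nhds h5)] with x a1 a2 a3 a4 a5 a6
  exact ⟨a1, a2, a3, a4, a5, a6⟩

/-- Bounds in the normalized coordinate `y = (x - c)/(1 - c)`, `r = c/(1-c)`. -/
lemma key (r y1 y2 y3 y4 : ℝ) (h0 : 0 < r) (hr1 : r < 1)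
    (e1 : y1 = 1 - (1 + r) * r ^ 2) (e2 : y2 = 1 - (1 + r) * y1 ^ 2)
    (e3 : y3 = 1 - (1 + r) * y2 ^ 2) (e4 : y4 = 1 - (1 + r) * y3 ^ 2)
    (hS : y1 < y4) (hl : y3 < y1) (hg : y4 < y2) : 199 / 301 < r ∧ r < 457 / 543 := by
  have h21 : y1 < y2 := by linarith
  have f1 : y3 + y1 < 0 := by
    have : 0 < (1 + r) * (y1 - y3) * (-(y3 + y1)) := by nlinarith
    have h := pos_of_mul_pos_right this (by nlinarith)
    linarith
  have f2 : 1 < (1 + r) * (y1 + y2) := by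
    have : 0 < (y2 - y1) * ((1 + r) * (y1 + y2) - 1) := by nlinarith
    have h := pos_of_mul_pos_right this (by linarith)
    linarith
  constructor
  · by_contra! hr
    obtain ⟨ρ, hρ⟩ : ∃ ρ : ℝ, ρ = 199 / 301 := ⟨_, rfl⟩
    rw [← hρ] at hr
    obtain ⟨Y, hY⟩ : ∃ Y : ℝ, Y = 1 - (1 + ρ) * ρ ^ 2 := ⟨_, rfl⟩
    have hYn : 0 < Y ∧ Y < 1 := by rw [hY, hρ]; norm_num
    have g1 : Y + (ρ - r) * (109 / 100) ≤ y1 := by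
      have : y1 - Y - (ρ - r) * (109 / 100)
          = (ρ - r) * (ρ ^ 2 + ρ + r * (ρ + r + 1) - 109 / 100) := by rw [e1, hY]; ring
      have a : 109 / 100 ≤ ρ ^ 2 + ρ := by rw [hρ]; norm_num
      have b : 0 ≤ r * (ρ + r + 1) := by
        apply mul_nonneg h0.le; linarith
      have := mul_nonneg (sub_nonneg.2 hr) (by linarith : 0 ≤ ρ ^ 2 + ρ + r * (ρ + r + 1) - 109 / 100)
      linarith
    have hd : 0 ≤ ρ - r := by linarith
    have g2 : Y ^ 2 + 2 * (109 / 100) * Y * (ρ - r) ≤ y1 ^ 2 := by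
      have : (Y + (ρ - r) * (109 / 100)) ^ 2 ≤ y1 ^ 2 :=
        pow_le_pow_left₀ (by nlinarith) g1 2
      nlinarith [sq_nonneg ((ρ - r) * (109 / 100))]
    have g3 : (1 + ρ) * Y ^ 2 ≤ (1 + r) * y1 ^ 2 := by
      have a := mul_le_mul_of_nonneg_left g2 (by linarith : 0 ≤ 1 + r)
      have p : 0 ≤ Y * (ρ - r) := mul_nonneg hYn.1.le hd
      have q := mul_nonneg p h0.le
      have s := mul_nonneg p (by linarith : 0 ≤ 1 - Y)
      nlinarith
    have g4 : y2 ≤ 1 - (1 + ρ) * Y ^ 2 := by linarith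
    have g5 : Y ≤ y1 := by linarith
    have g6 : y2 ^ 2 ≤ (1 - (1 + ρ) * Y ^ 2) ^ 2 := pow_le_pow_left₀ (by linarith) g4 2
    have g7 : (1 + r) * y2 ^ 2 ≤ (1 + ρ) * (1 - (1 + ρ) * Y ^ 2) ^ 2 :=
      mul_le_mul (by linarith) g6 (sq_nonneg _) (by linarith)
    have g8 : 0 ≤ Y + 1 - (1 + ρ) * (1 - (1 + ρ) * Y ^ 2) ^ 2 := by
      rw [hY, hρ]; norm_num
    linarith
  · by_contra! hr
    obtain ⟨ρ, hρ⟩ : ∃ ρ : ℝ, ρ = 457 / 543 := ⟨_, rfl⟩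
    rw [← hρ] at hr
    obtain ⟨Y, hY⟩ : ∃ Y : ℝ, Y = 1 - (1 + ρ) * ρ ^ 2 := ⟨_, rfl⟩
    have hYn : Y < 0 := by rw [hY, hρ]; norm_num
    have hρ0 : 0 < ρ := by rw [hρ]; norm_num
    have hd : 0 ≤ r - ρ := by linarith
    have g1 : y1 ≤ Y - (r - ρ) := by
      have : Y - (r - ρ) - y1
          = (r - ρ) * (ρ ^ 2 + ρ + r * (ρ + r + 1) - 1) := by rw [e1, hY]; ring
      have a : 1 ≤ ρ ^ 2 + ρ := by rw [hρ]; norm_num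
      have b : 0 ≤ r * (ρ + r + 1) := by
        apply mul_nonneg h0.le; linarith
      have := mul_nonneg hd (by linarith : 0 ≤ ρ ^ 2 + ρ + r * (ρ + r + 1) - 1)
      linarith
    have g2 : Y ^ 2 ≤ y1 ^ 2 := by nlinarith
    have g3 : (1 + ρ) * Y ^ 2 ≤ (1 + r) * y1 ^ 2 :=
      mul_le_mul (by linarith) g2 (sq_nonneg _) (by linarith)
    obtain ⟨S, hS'⟩ : ∃ S : ℝ, S = Y + (1 - (1 + ρ) * Y ^ 2) := ⟨_, rfl⟩
    have g4 : y1 + y2 ≤ S - (r - ρ) := by linarith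
    have g5 : (1 + ρ) * S ≤ 1 ∧ S ≤ 1 := by rw [hS', hY, hρ]; norm_num
    have g6 := mul_le_mul_of_nonneg_left g4 (by linarith : 0 ≤ 1 + r)
    have g7 := mul_nonneg hd (by linarith [g5.2] : 0 ≤ 1 - S)
    have g8 := mul_nonneg hd h0.le
    nlinarith [g5.1]

/-- The feasible domain `F_d` is a nonempty open subset of `ℝ`, contained in
`(0.398, 0.457)`. -/
theorem stmt_4 :
    IsOpen Fd ∧ Fd.Nonempty ∧ ∀ c ∈ Fd, 0.398 < c ∧ c < 0.457 := by
  refine ⟨fd_open, ⟨2 / 5, ?_⟩, ?_⟩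
  · simp only [Fd, Set.mem_ofPred_eq, Set.mem_Ioo, S1, S2, S3, Gl, Gr, uIter, u,
      Function.iterate_succ_apply', Function.iterate_zero, id]
    norm_num
  · rintro c ⟨⟨hc0, hc1⟩, h1, h2, h3, h4, h5⟩
    have hp : 0 < 1 - c := by linarith
    have hne : 1 - c ≠ 0 := hp.ne'
    have step : ∀ k, (uIter c (k + 1) - c) / (1 - c)
        = 1 - (1 + c / (1 - c)) * ((uIter c k - c) / (1 - c)) ^ 2 := by
      intro k
      simp only [uIter, Function.iterate_succ_apply']
      generalize (u c)^[k] 0 = x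
      unfold u
      field_simp
      ring
    have hz : uIter c 0 = 0 := rfl
    have s0 := step 0
    rw [hz] at s0
    simp only [S2, Gl, Gr] at h2 h4 h5
    have := key (c / (1 - c)) _ _ _ _ (by positivity) (by rw [div_lt_one hp]; linarith)
      (by rw [s0]; ring) (step 1) (step 2) (step 3)
      (by gcongr; linarith) (by gcongr; linarith) (by gcongr; linarith)
    rw [lt_div_iff₀ hp, div_lt_iff₀ hp] at this
    norm_num
    constructor <;> linarith [this.1, this.2]
end

section
/- Let c* be the unique c ∈ F_d with R(c) = c. Then there exist δ > 0 and a continuous, strictly decreasing function φ : (1 − δ, 1 + δ) → (0, 1/2) such that φ(1) = c* and R(φ(ε), ε) = φ(ε) for every ε ∈ (1 − δ, 1 + δ). In particular ε < 1 implies φ(ε) > c*, ε > 1 implies φ(ε) < c*, ε₀ < ε₁ implies φ(ε₁) < φ(ε₀), and the set {φ(ε) : ε ∈ (1 − δ, 1 + δ)} is a nondegenerate interval (a continuum of fixed-point parameters of the perturbed renormalization). -/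
/-- The ε-perturbed renormalization map
`R(c, ε) = (u_c(ε·u_c³(0)) − c)/(u_c(ε·u_c³(0)) − u_c(0))`. -/
noncomputable def Rpert (c ε : ℝ) : ℝ :=
  (u c (ε * uIter c 3) - c) / (u c (ε * uIter c 3) - u c 0)


namespace PT

/-- `w = t³ + t² - 1`. -/
noncomputable def w (t : ℝ) : ℝ := t ^ 3 + t ^ 2 - 1

/-- first factor -/
noncomputable def A (t : ℝ) : ℝ := (1 + t) * (t + Real.sqrt (1 - t ^ 3))

/-- second factor -/
noncomputable def B (t : ℝ) : ℝ := (1 + t) * w t * (2 - (1 + t) * w t ^ 2)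

/-- the function whose reciprocal is the perturbation parameter -/
noncomputable def M (t : ℝ) : ℝ := A t * B t

lemma s_bd {t : ℝ} (h1 : 189 / 250 ≤ t) (h2 : t ≤ 41 / 50) :
    2 / 3 ≤ Real.sqrt (1 - t ^ 3) := by
  apply Real.le_sqrt_of_sq_le
  have : t ^ 3 ≤ (41 / 50) ^ 3 := by gcongr
  norm_num at this ⊢
  linarith

lemma s_sq {t : ℝ} (h2 : t ≤ 1) : Real.sqrt (1 - t ^ 3) ^ 2 = 1 - t ^ 3 := by
  apply Real.sq_sqrt
  nlinarith [sq_nonneg t, sq_nonneg (t + 1), sq_nonneg (t + 1 / 2)]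

lemma w_pos {t : ℝ} (h1 : 189 / 250 ≤ t) : 0 < w t := by
  have h3 : (189 / 250) ^ 3 ≤ t ^ 3 := by gcongr
  have h4 : (189 / 250) ^ 2 ≤ t ^ 2 := by gcongr
  unfold w; norm_num at h3 h4; linarith

lemma w_lt {t : ℝ} (h1 : 189 / 250 ≤ t) (h2 : t ≤ 41 / 50) : w t < 9 / 40 := by
  have h3 : t ^ 3 ≤ (41 / 50) ^ 3 := by gcongr
  have h4 : t ^ 2 ≤ (41 / 50) ^ 2 := by gcongr
  unfold w; norm_num at h3 h4; linarith

lemma A_mono {a b : ℝ} (ha : 189 / 250 ≤ a) (hab : a < b) (hb : b ≤ 41 / 50) : A a < A b := by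
  have sa := s_bd ha (hab.le.trans hb)
  have sb := s_bd (ha.trans hab.le) hb
  have qa := s_sq (show a ≤ 1 by linarith)
  have qb := s_sq (show b ≤ 1 by linarith)
  unfold A
  set x := Real.sqrt (1 - a ^ 3)
  set y := Real.sqrt (1 - b ^ 3)
  have h0 : 0 < b - a := by linarith
  have e : (x - y) * (x + y) = (b - a) * (a ^ 2 + a * b + b ^ 2) := by
    linear_combination qa - qb
  have hq : a ^ 2 + a * b + b ^ 2 ≤ 2.0172 := by nlinarith
  have h1 : x - y ≤ (b - a) * 1.513 := by
    by_contra hcon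
    push Not at hcon
    have h5 : (b - a) * 1.513 * (4 / 3) < (x - y) * (x + y) := by
      have h6 : 0 < x - y := by nlinarith
      nlinarith
    nlinarith
  nlinarith

lemma B_mono {a b : ℝ} (ha : 189 / 250 ≤ a) (hab : a < b) (hb : b ≤ 41 / 50) : B a < B b := by
  have wa := w_pos ha
  have wb := w_lt (ha.trans hab.le) hb
  have h0 : 0 < b - a := by linarith
  have hw : w a < w b := by
    have h3 : a ^ 3 < b ^ 3 := by gcongr
    have h4 : a ^ 2 < b ^ 2 := by gcongr
    unfold w; linarith
  unfold B
  set x := w a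
  set y := w b
  have hv : (1 + a) * x + (y - x) ≤ (1 + b) * y := by nlinarith
  have hx : 0 < (1 + a) * x := by apply mul_pos <;> linarith
  have hy : (1 + b) * y ≤ 0.41 := by nlinarith
  have ea : (1 + a) * x * (2 - (1 + a) * x ^ 2) = 2 * ((1 + a) * x) - ((1 + a) * x) ^ 2 * x := by ring
  have eb : (1 + b) * y * (2 - (1 + b) * y ^ 2) = 2 * ((1 + b) * y) - ((1 + b) * y) ^ 2 * y := by ring
  rw [ea, eb]
  set P := (1 + a) * x
  set Q := (1 + b) * y
  have hPQ : P < Q := by linarith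
  have k1 : Q ^ 2 * y - P ^ 2 * x = (Q - P) * ((Q + P) * y) + P ^ 2 * (y - x) := by ring
  have k2 : (Q + P) * y ≤ 0.5 := by nlinarith
  have k3 : P ^ 2 ≤ 0.2 := by nlinarith
  have k4 : (Q - P) * ((Q + P) * y) ≤ (Q - P) * 0.5 :=
    mul_le_mul_of_nonneg_left k2 (by linarith)
  have k5 : P ^ 2 * (y - x) ≤ 0.2 * (y - x) := mul_le_mul_of_nonneg_right k3 (by linarith)
  nlinarith

lemma p_lt {t : ℝ} (h1 : 189 / 250 ≤ t) (h2 : t ≤ 41 / 50) : (1 + t) * w t ^ 2 < 1 := by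
  have h3 := w_pos h1
  have h4 := w_lt h1 h2
  have : w t ^ 2 < 1 / 4 := by nlinarith
  nlinarith

lemma B_pos {t : ℝ} (h1 : 189 / 250 ≤ t) (h2 : t ≤ 41 / 50) : 0 < B t := by
  have h3 := w_pos h1
  have h4 := p_lt h1 h2
  unfold B
  apply mul_pos (mul_pos _ h3) <;> linarith

lemma A_pos {t : ℝ} (h1 : 189 / 250 ≤ t) : 0 < A t := by
  have := Real.sqrt_nonneg (1 - t ^ 3)
  unfold A
  apply mul_pos <;> linarith

lemma M_mono : StrictMonoOn M (Set.Icc (189 / 250) (41 / 50)) := by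
  intro a ha b hb hab
  exact mul_lt_mul'' (A_mono ha.1 hab hb.2) (B_mono ha.1 hab hb.2) (A_pos ha.1).le
    (B_pos ha.1 ha.2).le

lemma M_cont : Continuous M := by
  unfold M A B w
  fun_prop

lemma u_t {t : ℝ} (ht : 0 < t) (x : ℝ) : u (t / (1 + t)) x = 1 - ((1 + t) * x - t) ^ 2 := by
  unfold u
  have : (1 : ℝ) + t ≠ 0 := by positivity
  have h2 : 1 - t / (1 + t) = 1 / (1 + t) := by field_simp; ring
  rw [h2]; field_simp

lemma it1 {t : ℝ} (ht : 0 < t) : uIter (t / (1 + t)) 1 = 1 - t ^ 2 := by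
  simp [uIter, u_t ht]

lemma it2 {t : ℝ} (ht : 0 < t) : uIter (t / (1 + t)) 2 = 1 - w t ^ 2 := by
  simp [uIter, u_t ht, w]; ring

lemma it3 {t : ℝ} (ht : 0 < t) : uIter (t / (1 + t)) 3 =
    (1 + t) * w t ^ 2 * (2 - (1 + t) * w t ^ 2) := by
  have h : uIter (t / (1 + t)) 3 = u (t / (1 + t)) (uIter (t / (1 + t)) 2) := by
    simp [uIter]
  rw [h, it2 ht, u_t ht]; ring

lemma it4 {t : ℝ} (ht : 0 < t) : uIter (t / (1 + t)) 4 =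
    1 - ((1 + t) * uIter (t / (1 + t)) 3 - t) ^ 2 := by
  have h : uIter (t / (1 + t)) 4 = u (t / (1 + t)) (uIter (t / (1 + t)) 3) := by
    simp [uIter]
  rw [h, u_t ht]

lemma fwd {t : ℝ} (ht : 0 < t) (hc : t / (1 + t) ∈ Fd)
    (hfix : Rmap (t / (1 + t)) = t / (1 + t)) :
    189 / 250 < t ∧ t < 41 / 50 ∧ M t = 1 := by
  obtain ⟨⟨-, hlt⟩, h1, h2, h3, h4, h5⟩ := hc
  have h1t : (0 : ℝ) < 1 + t := by positivity
  have ht1 : t < 1 := by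
    rw [div_lt_iff₀ h1t] at hlt; linarith
  unfold Rmap at hfix
  rw [div_eq_iff h2.ne'] at hfix
  unfold S1 at h1
  unfold S2 at h2 hfix
  unfold Gl at h4
  unfold Gr at h5
  rw [it1 ht] at h2 h4 hfix
  rw [it2 ht] at h5
  have hu4 : uIter (t / (1 + t)) 4 = t ^ 3 := by
    field_simp at hfix
    linear_combination hfix
  rw [hu4] at h2 h5
  have hw : 0 < w t := by unfold w; linarith
  have e4 := it4 ht
  rw [hu4] at e4
  have e3 := it3 ht
  set y := uIter (t / (1 + t)) 3
  have ss := s_sq ht1.le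
  have sn := Real.sqrt_nonneg (1 - t ^ 3)
  have hM : M t = (1 + t) ^ 2 * w t * (2 - (1 + t) * w t ^ 2) * (t + Real.sqrt (1 - t ^ 3)) := by
    unfold M A B; ring
  set s := Real.sqrt (1 - t ^ 3)
  have hyt : (1 + t) * y < t := by
    have : (1 + t) * y < (1 + t) * (1 - t ^ 2) := by
      apply mul_lt_mul_of_pos_left _ h1t; linarith
    unfold w at hw; nlinarith
  have hys : (1 + t) * y = t - s := by
    have : (t - (1 + t) * y) ^ 2 = s ^ 2 := by rw [ss]; linear_combination e4
    have := (pow_left_inj₀ (by linarith) sn (two_ne_zero)).1 this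
    linarith
  have hts : (t - s) * (t + s) = w t := by
    unfold w; linear_combination -ss
  have hM1 : M t = 1 := by
    apply mul_left_cancel₀ hw.ne'
    rw [hM, mul_one]
    rw [e3] at hys
    linear_combination (t + s) * hys + hts
  have htl : 3 / 4 < t := by
    by_contra hcon
    push Not at hcon
    have h3 : t ^ 3 ≤ (3 / 4) ^ 3 := by gcongr
    have h4 : t ^ 2 ≤ (3 / 4) ^ 2 := by gcongr
    unfold w at hw; norm_num at h3 h4; linarith
  have hp : (1 + t) * w t ^ 2 < 1 / 4 := by
    have k0 : (3 / 4) ^ 3 < t ^ 3 := by gcongr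
    have k1 : w t ^ 2 < 0.58 := by norm_num at k0 ⊢; linarith
    have k2 : (1 + t) * w t ^ 2 < 1.2 := by
      have : (1 + t) * w t ^ 2 ≤ 2 * 0.58 := by gcongr; linarith
      norm_num at this ⊢; linarith
    have k3 : (1 + t) * w t ^ 2 * (2 - (1 + t) * w t ^ 2) < 7 / 16 := by
      rw [← e3]
      have : (3 / 4 : ℝ) ^ 2 < t ^ 2 := by gcongr
      norm_num at this
      linarith
    generalize (1 + t) * w t ^ 2 = p at k2 k3
    by_contra hcon
    push Not at hcon
    have := mul_nonneg (sub_nonneg.2 hcon) (show 0 ≤ 7 / 4 - p by linarith)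
    linarith
  have hp0 : 0 ≤ (1 + t) * w t ^ 2 := by positivity
  have hts1 : 1 ≤ t + s := by
    have q1 : 0 ≤ t * s := by positivity
    have q2 : t ^ 2 + s ^ 2 = 1 + t ^ 2 * (1 - t) := by rw [ss]; ring
    have q3 : 0 ≤ t ^ 2 * (1 - t) := mul_nonneg (sq_nonneg t) (by linarith)
    by_contra hcon
    push Not at hcon
    have q4 : (t + s) ^ 2 < 1 := by
      have : 0 ≤ t + s := by linarith
      nlinarith only [this, hcon]
    linarith [show (t + s) ^ 2 = t ^ 2 + s ^ 2 + 2 * (t * s) by ring]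
  have hs1 : s ≤ 1 := by
    have : 0 ≤ t ^ 3 := by positivity
    nlinarith only [this, ss, sn]
  rw [hM1] at hM
  refine ⟨?_, ?_, hM1⟩
  · by_contra hcon
    push Not at hcon
    have k3 : t ^ 3 ≤ (189 / 250) ^ 3 := by gcongr
    have k4 : t ^ 2 ≤ (189 / 250) ^ 2 := by gcongr
    have k5 : w t ≤ 1 / 250 := by unfold w; norm_num at k3 k4 ⊢; linarith
    have : (1 + t) ^ 2 * w t * (2 - (1 + t) * w t ^ 2) * (t + s) ≤ 2 ^ 2 * (1 / 250) * 2 * 2 := by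
      gcongr <;> linarith
    norm_num at this; linarith
  · by_contra hcon
    push Not at hcon
    have k3 : (41 / 50) ^ 3 ≤ t ^ 3 := by gcongr
    have k4 : (41 / 50) ^ 2 ≤ t ^ 2 := by gcongr
    have k5 : 1 / 5 ≤ w t := by unfold w; norm_num at k3 k4 ⊢; linarith
    have : (1 + 3 / 4 : ℝ) ^ 2 * (1 / 5) * (7 / 4) * 1 ≤
        (1 + t) ^ 2 * w t * (2 - (1 + t) * w t ^ 2) * (t + s) := by
      have hq : 7 / 4 ≤ 2 - (1 + t) * w t ^ 2 := by linarith
      generalize 2 - (1 + t) * w t ^ 2 = q at hq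
      have : 0 < q := by linarith
      gcongr
    norm_num at this; linarith

lemma bwd {t ε : ℝ} (h1 : 189 / 250 ≤ t) (h2 : t ≤ 41 / 50) (hM : M t * ε = 1) :
    Rpert (t / (1 + t)) ε = t / (1 + t) := by
  have ht : 0 < t := by linarith
  have hw := w_pos h1
  have ss := s_sq (show t ≤ 1 by linarith)
  have hts : (t - Real.sqrt (1 - t ^ 3)) * (t + Real.sqrt (1 - t ^ 3)) = w t := by
    unfold w; linear_combination -ss
  have sn := Real.sqrt_nonneg (1 - t ^ 3)
  have key : (1 + t) * (ε * uIter (t / (1 + t)) 3) = t - Real.sqrt (1 - t ^ 3) := by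
    rw [it3 ht]
    unfold M A B at hM
    set s := Real.sqrt (1 - t ^ 3)
    have : t + s ≠ 0 := by positivity
    apply mul_right_cancel₀ this
    rw [hts]
    linear_combination w t * hM
  have hv : u (t / (1 + t)) (ε * uIter (t / (1 + t)) 3) = t ^ 3 := by
    rw [u_t ht, key]; linear_combination -ss
  have h0 : u (t / (1 + t)) 0 = 1 - t ^ 2 := by rw [u_t ht]; ring
  unfold Rpert
  rw [hv, h0]
  have hne : t ^ 3 - (1 - t ^ 2) ≠ 0 := by unfold w at hw; linarith
  rw [div_eq_iff hne]
  field_simp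
  ring

/-- Continuous inverse of `M`. -/
lemma exists_inv : ∃ θ : ℝ → ℝ,
    (∀ t ∈ Set.Icc (189 / 250 : ℝ) (41 / 50), θ (M t) = t) ∧
    (∀ x ∈ Set.Ioo (M (189 / 250)) (M (41 / 50)),
      θ x ∈ Set.Ioo (189 / 250 : ℝ) (41 / 50) ∧ M (θ x) = x ∧ ContinuousAt θ x) ∧
    StrictMonoOn θ (Set.Ioo (M (189 / 250)) (M (41 / 50))) := by
  set J := Set.Icc (189 / 250 : ℝ) (41 / 50)
  have hinv : ∀ t ∈ J, Function.invFunOn M J (M t) = t :=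
    fun t ht => M_mono.injOn.leftInvOn_invFunOn ht
  have hsurj : ∀ x ∈ Set.Ioo (M (189 / 250)) (M (41 / 50)),
      ∃ t ∈ Set.Ioo (189 / 250 : ℝ) (41 / 50), M t = x := fun x hx =>
    intermediate_value_Ioo (by norm_num) M_cont.continuousOn hx
  have hmono : StrictMonoOn (Function.invFunOn M J)
      (Set.Ioo (M (189 / 250)) (M (41 / 50))) := by
    intro x hx y hy hxy
    obtain ⟨a, ha, rfl⟩ := hsurj x hx
    obtain ⟨b, hb, rfl⟩ := hsurj y hy
    rw [hinv a (Set.Ioo_subset_Icc_self ha), hinv b (Set.Ioo_subset_Icc_self hb)]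
    exact (M_mono.lt_iff_lt (Set.Ioo_subset_Icc_self ha) (Set.Ioo_subset_Icc_self hb)).1 hxy
  refine ⟨Function.invFunOn M J, hinv, ?_, hmono⟩
  intro x hx
  obtain ⟨t, ht, rfl⟩ := hsurj x hx
  have e := hinv t (Set.Ioo_subset_Icc_self ht)
  refine ⟨e.symm ▸ ht, by rw [e], ?_⟩
  apply hmono.continuousAt_of_image_mem_nhds (isOpen_Ioo.mem_nhds hx)
  rw [e]
  filter_upwards [isOpen_Ioo.mem_nhds ht] with b hb
  have hb' := Set.Ioo_subset_Icc_self hb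
  refine ⟨M b, ⟨M_mono ?_ hb' hb.1, M_mono hb' ?_ hb.2⟩, hinv b hb'⟩ <;>
  constructor <;> norm_num

end PT

open PT in
/-- Around the unique fixed point `c*` of the period-tripling renormalization,
there is a continuous strictly decreasing curve `ε ↦ φ(ε)` of fixed points of
the ε-perturbed renormalization, with `φ(1) = c*`, whose image is a
nondegenerate interval: a continuum of fixed-point parameters. -/
theorem stmt_9 (cstar : ℝ) (hc : cstar ∈ Fd) (hfix : Rmap cstar = cstar)
    (huniq : ∀ c ∈ Fd, Rmap c = c → c = cstar) :
    ∃ δ > (0 : ℝ), ∃ φ : ℝ → ℝ,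
      ContinuousOn φ (Set.Ioo (1 - δ) (1 + δ)) ∧
      StrictAntiOn φ (Set.Ioo (1 - δ) (1 + δ)) ∧
      (∀ ε ∈ Set.Ioo (1 - δ) (1 + δ), φ ε ∈ Set.Ioo (0 : ℝ) (1 / 2)) ∧
      φ 1 = cstar ∧
      (∀ ε ∈ Set.Ioo (1 - δ) (1 + δ), Rpert (φ ε) ε = φ ε) ∧
      (∀ ε ∈ Set.Ioo (1 - δ) (1 + δ), ε < 1 → cstar < φ ε) ∧
      (∀ ε ∈ Set.Ioo (1 - δ) (1 + δ), 1 < ε → φ ε < cstar) ∧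
      (∀ ε₀ ∈ Set.Ioo (1 - δ) (1 + δ), ∀ ε₁ ∈ Set.Ioo (1 - δ) (1 + δ),
        ε₀ < ε₁ → φ ε₁ < φ ε₀) ∧
      ∃ a b : ℝ, a < b ∧ φ '' Set.Ioo (1 - δ) (1 + δ) = Set.Ioo a b := by
  obtain ⟨θ, hθ1, hθ2, hθ3⟩ := exists_inv
  have hc01 := hc.1
  set ts := cstar / (1 - cstar) with hts
  have h1c : 0 < 1 - cstar := by linarith [hc01.2]
  have htp : 0 < ts := div_pos hc01.1 h1c
  have hcs : ts / (1 + ts) = cstar := by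
    rw [hts]; field_simp; ring
  obtain ⟨ha, hb, hM⟩ := fwd htp (hcs.symm ▸ hc) (hcs.symm ▸ hfix)
  have hJ : ts ∈ Set.Icc (189 / 250 : ℝ) (41 / 50) := ⟨ha.le, hb.le⟩
  have h1mem : (1 : ℝ) ∈ Set.Ioo (M (189 / 250)) (M (41 / 50)) := by
    rw [← hM]
    constructor <;> apply M_mono <;> first | assumption | (constructor <;> norm_num)
  have hev : ∀ᶠ ε : ℝ in nhds 1, ε⁻¹ ∈ Set.Ioo (M (189 / 250)) (M (41 / 50)) ∧ 0 < ε := by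
    apply Filter.Eventually.and
    · have : ContinuousAt (fun ε : ℝ => ε⁻¹) 1 := continuousAt_inv₀ one_ne_zero
      apply this
      simpa using isOpen_Ioo.mem_nhds h1mem
    · exact lt_mem_nhds one_pos
  obtain ⟨d, hd, hball⟩ := Metric.eventually_nhds_iff_ball.1 hev
  rw [Real.ball_eq_Ioo] at hball
  set φ : ℝ → ℝ := fun ε => θ ε⁻¹ / (1 + θ ε⁻¹) with hφ
  have hpos : ∀ ε ∈ Set.Ioo (1 - d) (1 + d), 0 < θ ε⁻¹ := fun ε hε => by
    have := (hθ2 _ (hball ε hε).1).1.1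
    linarith
  have hcont : ContinuousOn φ (Set.Ioo (1 - d) (1 + d)) := by
    intro ε hε
    apply ContinuousAt.continuousWithinAt
    have h1 : ContinuousAt (fun ε : ℝ => θ ε⁻¹) ε :=
      ContinuousAt.comp (g := θ) (hθ2 _ (hball ε hε).1).2.2
        (continuousAt_inv₀ (hball ε hε).2.ne')
    have := hpos ε hε
    exact h1.div (continuousAt_const.add h1) (by positivity)
  have hanti : StrictAntiOn φ (Set.Ioo (1 - d) (1 + d)) := by
    intro x hx y hy hxy
    have h1 : y⁻¹ < x⁻¹ := inv_strictAnti₀ (hball x hx).2 hxy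
    have h2 := hθ3 (hball y hy).1 (hball x hx).1 h1
    have px := hpos x hx
    have py := hpos y hy
    simp only [hφ]
    rw [div_lt_div_iff₀ (by linarith) (by linarith)]
    nlinarith
  have hφ1 : φ 1 = cstar := by
    have h := hθ1 ts hJ
    rw [hM] at h
    simp only [hφ, inv_one]
    rw [h, hcs]
  have hsub : Set.Icc (1 - d / 2) (1 + d / 2) ⊆ Set.Ioo (1 - d) (1 + d) := fun x hx =>
    ⟨by linarith [hx.1], by linarith [hx.2]⟩
  have hsub' : Set.Ioo (1 - d / 2) (1 + d / 2) ⊆ Set.Ioo (1 - d) (1 + d) :=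
    Set.Ioo_subset_Icc_self.trans hsub
  have hanti' := hanti.mono hsub'
  have hone : (1 : ℝ) ∈ Set.Ioo (1 - d / 2) (1 + d / 2) := ⟨by linarith, by linarith⟩
  have hle : 1 - d / 2 ≤ 1 + d / 2 := by linarith
  have hl : 1 - d / 2 ∈ Set.Icc (1 - d / 2) (1 + d / 2) := ⟨le_rfl, hle⟩
  have hr : 1 + d / 2 ∈ Set.Icc (1 - d / 2) (1 + d / 2) := ⟨hle, le_rfl⟩
  refine ⟨d / 2, by linarith, φ, hcont.mono hsub', hanti', ?_, hφ1, ?_, ?_, ?_, ?_,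
    φ (1 + d / 2), φ (1 - d / 2), hanti (hsub hl) (hsub hr) (by linarith), ?_⟩
  · intro ε hε
    have h := hpos ε (hsub' hε)
    have h2 := (hθ2 _ (hball ε (hsub' hε)).1).1.2
    refine ⟨by simp only [hφ]; positivity, ?_⟩
    simp only [hφ]
    rw [div_lt_iff₀ (by linarith)]
    linarith
  · intro ε hε
    obtain ⟨h1, h2⟩ := hball ε (hsub' hε)
    obtain ⟨h3, h4, -⟩ := hθ2 _ h1
    exact bwd h3.1.le h3.2.le (by rw [h4, inv_mul_cancel₀ h2.ne'])
  · intro ε hε h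
    rw [← hφ1]; exact hanti' hε hone h
  · intro ε hε h
    rw [← hφ1]; exact hanti' hone hε h
  · intro x hx y hy h
    exact hanti' hx hy h
  · apply Set.Subset.antisymm
    · rintro _ ⟨x, hx, rfl⟩
      exact ⟨hanti (hsub' hx) (hsub hr) hx.2, hanti (hsub hl) (hsub' hx) hx.1⟩
    · exact intermediate_value_Ioo' hle (hcont.mono hsub)
end

section
/- If c ∈ F_d satisfies R(c) = c, then u_c is strictly increasing on the interval I₁¹ = [0, u_c³(0)] and maps it bijectively onto I₂¹ = [u_c(0), u_c⁴(0)], and u_c is strictly decreasing on the interval I₃¹ = [u_c²(0), 1] and maps it bijectively onto I₁¹ = [0, u_c³(0)] (realizing the period-tripling combinatorics I₃ → I₁ → I₂ on monotone branches of u_c). -/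
/-- At a fixed point of the period-tripling renormalization, `u_c` is strictly
increasing on `I₁¹ = [0, u_c³(0)]`, mapping it bijectively onto
`I₂¹ = [u_c(0), u_c⁴(0)]`, and strictly decreasing on `I₃¹ = [u_c²(0), 1]`,
mapping it bijectively onto `I₁¹ = [0, u_c³(0)]`. -/
theorem stmt_11 (c : ℝ) (hc : c ∈ Fd) (hfix : Rmap c = c) :
    StrictMonoOn (u c) (Set.Icc 0 (uIter c 3)) ∧
    Set.BijOn (u c) (Set.Icc 0 (uIter c 3)) (Set.Icc (uIter c 1) (uIter c 4)) ∧
    StrictAntiOn (u c) (Set.Icc (uIter c 2) 1) ∧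
    Set.BijOn (u c) (Set.Icc (uIter c 2) 1) (Set.Icc 0 (uIter c 3)) := by
  obtain ⟨⟨h0, h1⟩, hS1, hS2, hS3, hGl, hGr⟩ := hc
  unfold Rmap at hfix
  rw [div_eq_iff hS2.ne'] at hfix
  unfold S1 at hS1
  unfold S2 at hS2 hfix
  unfold S3 at hS3
  unfold Gl at hGl
  unfold Gr at hGr
  have e1 : u c 0 = uIter c 1 := rfl
  have e3 : u c (uIter c 2) = uIter c 3 := by
    simp [uIter, Function.iterate_succ_apply']
  have e4 : u c (uIter c 3) = uIter c 4 := by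
    simp [uIter, Function.iterate_succ_apply']
  have hc1 : 0 < 1 - c := by linarith
  have eu1 : u c 1 = 0 := by
    unfold u
    rw [div_self hc1.ne']
    norm_num
  have hcont : Continuous (u c) := by
    unfold u
    fun_prop
  have hx1 : uIter c 1 < c := by nlinarith
  have hx4 : c < uIter c 4 := by nlinarith
  have hmono : StrictMonoOn (u c) (Set.Icc 0 (uIter c 3)) := by
    intro x hx y hy hxy
    have hyc : y ≤ c := by linarith [hy.2]
    unfold u
    rw [div_pow, div_pow]
    have : (y - c) ^ 2 < (x - c) ^ 2 := by nlinarith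
    have := div_lt_div_of_pos_right this (pow_pos hc1 2)
    linarith
  have hanti : StrictAntiOn (u c) (Set.Icc (uIter c 2) 1) := by
    intro x hx y hy hxy
    have hyc : c ≤ x := by linarith [hx.1]
    unfold u
    rw [div_pow, div_pow]
    have : (x - c) ^ 2 < (y - c) ^ 2 := by nlinarith
    have := div_lt_div_of_pos_right this (pow_pos hc1 2)
    linarith
  have h21 : uIter c 2 ≤ 1 := by linarith
  refine ⟨hmono, ⟨?_, hmono.injOn, ?_⟩, hanti, ⟨?_, hanti.injOn, ?_⟩⟩
  · have := hmono.monotoneOn.mapsTo_Icc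
    rwa [e1, e4] at this
  · have := intermediate_value_Icc hS1.le hcont.continuousOn
    rwa [e1, e4] at this
  · have := hanti.antitoneOn.mapsTo_Icc
    rwa [eu1, e3] at this
  · have := intermediate_value_Icc' h21 hcont.continuousOn
    rwa [eu1, e3] at this
end

section
/- There exist ε₀ > ε₁ > ε₂ in a neighborhood of 1, fixed points c₀* < c₁* < c₂* in (0, 1/2) with R(c_i*, ε_i) = c_i* and ∂R/∂c(c_i*, ε_i) > 2 for i = 0, 1, 2, and pairwise disjoint closed intervals A₀ = [c₀*, a₀], A₁ = [a₁, b₁], A₂ = [a₂, c₂*] contained in [c₀*, c₂*], such that for each i the map c ↦ R(c, ε_i) restricted to A_i is a diffeomorphism onto [c₀*, c₂*] with derivative of absolute value greater than 1 throughout A_i (an expanding full horseshoe with three branches on parameter space). -/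
namespace Horseshoe

noncomputable def K (c : ℝ) : ℝ := (1 - c)⁻¹
noncomputable def T (c : ℝ) : ℝ := c * K c
noncomputable def A (c : ℝ) : ℝ := 1 - T c * T c
noncomputable def S (c : ℝ) : ℝ := (c - A c) * K c
noncomputable def B (c : ℝ) : ℝ := 1 - S c * S c
noncomputable def P (c : ℝ) : ℝ := (B c - c) * K c
noncomputable def W (c : ℝ) : ℝ := 1 - P c * P c

lemma uIter_three (c : ℝ) : uIter c 3 = W c := by
  simp only [uIter, Function.iterate_succ, Function.iterate_zero, Function.comp, id, u, W, P, B, S,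
    A, T, K]
  ring

lemma mulb {x y a b c d : ℝ} (ha : 0 ≤ a) (hc : 0 ≤ c) (hx : a ≤ x ∧ x ≤ b) (hy : c ≤ y ∧ y ≤ d) :
    a * c ≤ x * y ∧ x * y ≤ b * d := by
  obtain ⟨h1, h2⟩ := hx
  obtain ⟨h3, h4⟩ := hy
  exact ⟨mul_le_mul h1 h3 hc (ha.trans h1),
    mul_le_mul h2 h4 (hc.trans h3) (ha.trans (h1.trans h2))⟩

/-- Bounds for `W` and its derivative on the parameter window. -/
lemma W_bounds (c : ℝ) (hc : 0.4398 ≤ c ∧ c ≤ 0.4402) :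
    (0.0335 ≤ W c ∧ W c ≤ 0.0408) ∧ ∃ w', HasDerivAt W w' c ∧ 7.65 ≤ w' := by
  obtain ⟨hc1, hc2⟩ := hc
  have hpos : 0 < 1 - c := by linarith
  have hk : 1.785 ≤ K c ∧ K c ≤ 1.7864 := by
    unfold K
    constructor
    · rw [le_inv_comm₀ (by norm_num) hpos]
      norm_num
      linarith
    · rw [inv_le_comm₀ hpos (by norm_num)]
      norm_num
      linarith
  have ht : 0.785 ≤ T c ∧ T c ≤ 0.7864 := by
    have := mulb (by norm_num) (by norm_num) ⟨hc1, hc2⟩ hk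
    norm_num at this
    unfold T
    constructor <;> linarith
  have ha : 0.3815 ≤ A c ∧ A c ≤ 0.3838 := by
    have := mulb (by norm_num) (by norm_num) ht ht
    norm_num at this
    unfold A
    constructor <;> linarith
  have hk2 : 3.1862 ≤ K c * K c ∧ K c * K c ≤ 3.1913 := by
    have := mulb (by norm_num) (by norm_num) hk hk
    norm_num at this
    constructor <;> linarith
  have hna : 2.5011 ≤ T c * (K c * K c) ∧ T c * (K c * K c) ≤ 2.5097 := by
    have := mulb (by norm_num) (by norm_num) ht hk2
    norm_num at this
    constructor <;> linarith
  have hca : 0.056 ≤ c - A c ∧ c - A c ≤ 0.0587 := by constructor <;> linarith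
  have hs : 0.0999 ≤ S c ∧ S c ≤ 0.1049 := by
    have := mulb (by norm_num) (by norm_num) hca hk
    norm_num at this
    unfold S
    constructor <;> linarith
  have hb : 0.9889 ≤ B c ∧ B c ≤ 0.9901 := by
    have := mulb (by norm_num) (by norm_num) hs hs
    norm_num at this
    unfold B
    constructor <;> linarith
  obtain ⟨s', hs'⟩ : ∃ s', s' = (1 + 2 * (T c * (K c * K c))) * K c + (c - A c) * (K c * K c) :=
    ⟨_, rfl⟩
  have hds : 10.89 ≤ s' ∧ s' ≤ 10.941 := by
    have h1 : 6.0022 ≤ 1 + 2 * (T c * (K c * K c)) ∧ 1 + 2 * (T c * (K c * K c)) ≤ 6.0194 := by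
      constructor <;> linarith
    have h2 := mulb (by norm_num) (by norm_num) h1 hk
    have h3 := mulb (by norm_num) (by norm_num) hca hk2
    norm_num at h2 h3
    constructor <;> linarith
  have hnb : 1.0875 ≤ S c * s' ∧ S c * s' ≤ 1.148 := by
    have := mulb (by norm_num) (by norm_num) hs hds
    norm_num at this
    constructor <;> linarith
  have hbc : 0.5487 ≤ B c - c ∧ B c - c ≤ 0.5503 := by constructor <;> linarith
  have hp : 0.9794 ≤ P c ∧ P c ≤ 0.9831 := by
    have := mulb (by norm_num) (by norm_num) hbc hk
    norm_num at this
    unfold P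
    constructor <;> linarith
  have hw : 0.0335 ≤ W c ∧ W c ≤ 0.0408 := by
    have := mulb (by norm_num) (by norm_num) hp hp
    norm_num at this
    unfold W
    constructor <;> linarith
  obtain ⟨q', hq'⟩ : ∃ q', q' = (1 + 2 * (S c * s')) * K c - (B c - c) * (K c * K c) := ⟨_, rfl⟩
  have hq : 3.91 ≤ q' ∧ q' ≤ 5 := by
    have h1 : 3.175 ≤ 1 + 2 * (S c * s') ∧ 1 + 2 * (S c * s') ≤ 3.296 := by
      constructor <;> linarith
    have h2 := mulb (by norm_num) (by norm_num) h1 hk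
    have h3 := mulb (by norm_num) (by norm_num) hbc hk2
    norm_num at h2 h3
    constructor <;> linarith
  refine ⟨hw, 2 * (P c * q'), ?_, ?_⟩
  · have hne : 1 - c ≠ 0 := hpos.ne'
    have dK : HasDerivAt K (K c * K c) c := by
      have := ((hasDerivAt_id c).const_sub 1).inv hne
      refine HasDerivAt.congr_deriv (f := K) this ?_
      simp only [K, id]
      field_simp
    have hcK : (1 - c) * K c = 1 := mul_inv_cancel₀ hne
    have dT : HasDerivAt T (K c * K c) c := by
      have := (hasDerivAt_id c).mul dK
      refine HasDerivAt.congr_deriv (f := T) this ?_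
      simp only [id]
      linear_combination -K c * hcK
    have dA : HasDerivAt A (-(2 * (T c * (K c * K c)))) c := by
      have := (dT.mul dT).const_sub 1
      refine HasDerivAt.congr_deriv (f := A) this ?_
      ring
    have dS : HasDerivAt S s' c := by
      have := ((hasDerivAt_id c).sub dA).mul dK
      refine HasDerivAt.congr_deriv (f := S) this ?_
      simp only [id, Pi.sub_apply]
      rw [hs']
      ring
    have dB : HasDerivAt B (-(2 * (S c * s'))) c := by
      have := (dS.mul dS).const_sub 1
      refine HasDerivAt.congr_deriv (f := B) this ?_
      ring
    have dP : HasDerivAt P (-q') c := by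
      have := (dB.sub (hasDerivAt_id c)).mul dK
      refine HasDerivAt.congr_deriv (f := P) this ?_
      simp only [id, Pi.sub_apply]
      rw [hq']
      ring
    have := (dP.mul dP).const_sub 1
    refine HasDerivAt.congr_deriv (f := W) this ?_
    ring
  · have := mulb (by norm_num) (by norm_num) hp hq
    norm_num at this
    linarith

lemma Rpert_eq (c ε : ℝ) (hc : 0.4398 ≤ c ∧ c ≤ 0.4402) (he : 1 ≤ ε ∧ ε ≤ 1.05) :
    Rpert c ε = 1 - (c ^ 2 - (1 - c) ^ 3) / (ε * W c * (2 * c - ε * W c)) := by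
  have hw := (W_bounds c hc).1
  have hx := mulb (by norm_num) (by norm_num) he hw
  obtain ⟨hc1, hc2⟩ := hc
  have hne : 1 - c ≠ 0 := by linarith
  norm_num at hx
  have h1 : ε * W c ≠ 0 := by linarith
  have h2 : 2 * c - ε * W c ≠ 0 := by linarith
  have hD : u c (ε * uIter c 3) - u c 0 = ε * W c * (2 * c - ε * W c) / (1 - c) ^ 2 := by
    rw [uIter_three]
    unfold u
    field_simp
    ring
  have hN : u c (ε * uIter c 3) - c =
      (ε * W c * (2 * c - ε * W c) - (c ^ 2 - (1 - c) ^ 3)) / (1 - c) ^ 2 := by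
    rw [uIter_three]
    unfold u
    field_simp
    ring
  unfold Rpert
  rw [hD, hN, div_div_div_cancel_right₀ (pow_ne_zero 2 hne), sub_div, div_self (mul_ne_zero h1 h2)]

lemma Rpert_deriv (c ε : ℝ) (hc : c ∈ Set.Ioo (0.4398 : ℝ) 0.4402) (he : 1 ≤ ε ∧ ε ≤ 1.05) :
    DifferentiableAt ℝ (fun c => Rpert c ε) c ∧ 2 < deriv (fun c => Rpert c ε) c := by
  have hev : (fun c => Rpert c ε) =ᶠ[nhds c]
      fun c => 1 - (c ^ 2 - (1 - c) ^ 3) / (ε * W c * (2 * c - ε * W c)) := by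
    filter_upwards [Ioo_mem_nhds hc.1 hc.2] with y hy
    exact Rpert_eq y ε ⟨hy.1.le, hy.2.le⟩ he
  obtain ⟨hw, w', hd, hw'⟩ := W_bounds c ⟨hc.1.le, hc.2.le⟩
  obtain ⟨hc1, hc2⟩ := hc
  have hx := mulb (by norm_num) (by norm_num) he hw
  norm_num at hx
  have h1 : 0 < ε * W c := by linarith
  have h2 : 0 < 2 * c - ε * W c := by linarith
  have dQ : HasDerivAt (fun c => ε * W c * (2 * c - ε * W c))
      (ε * w' * (2 * c - ε * W c) + ε * W c * (2 - ε * w')) c := by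
    have e1 := hd.const_mul ε
    have e2 := ((hasDerivAt_id c).const_mul 2).sub e1
    have := e1.mul e2
    refine HasDerivAt.congr_deriv this ?_
    simp
  have dN : HasDerivAt (fun c : ℝ => c ^ 2 - (1 - c) ^ 3) (2 * c + 3 * (1 - c) ^ 2) c := by
    have := ((hasDerivAt_id c).pow 2).sub (((hasDerivAt_id c).const_sub 1).pow 3)
    refine HasDerivAt.congr_deriv this ?_
    simp
  have dR := (((dN.div dQ (mul_pos h1 h2).ne').const_sub 1).congr_of_eventuallyEq hev)
  refine ⟨dR.differentiableAt, ?_⟩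
  rw [dR.deriv, ← neg_div, lt_div_iff₀ (by positivity)]
  have hp : 0.0176 ≤ c ^ 2 - (1 - c) ^ 3 := by nlinarith [sq_nonneg (c - 0.4398)]
  have hp' : 2 * c + 3 * (1 - c) ^ 2 ≤ 1.822 := by nlinarith
  have hp'0 : 0 ≤ 2 * c + 3 * (1 - c) ^ 2 := by nlinarith
  have hQ : ε * W c * (2 * c - ε * W c) ≤ ε * 0.03593 := by
    have h3 : 2 * c - ε * W c ≤ 0.8804 := by linarith
    have h4 := mul_le_mul hw.2 h3 h2.le (by norm_num)
    have := mul_le_mul_of_nonneg_left h4 (by linarith : 0 ≤ ε)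
    nlinarith
  have hQ0 : 0 < ε * W c * (2 * c - ε * W c) := mul_pos h1 h2
  have hQ' : ε * 6.07 ≤ ε * w' * (2 * c - ε * W c) + ε * W c * (2 - ε * w') := by
    have h3 : 0.7939 ≤ 2 * c - 2 * (ε * W c) := by linarith
    have h4 := mul_le_mul hw' h3 (by norm_num) (by linarith)
    have := mul_le_mul_of_nonneg_left h4 (by linarith : 0 ≤ ε)
    nlinarith
  generalize ε * w' * (2 * c - ε * W c) + ε * W c * (2 - ε * w') = Q' at *
  generalize ε * W c * (2 * c - ε * W c) = Q at *
  generalize c ^ 2 - (1 - c) ^ 3 = N at *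
  generalize 2 * c + 3 * (1 - c) ^ 2 = N' at *
  have e1 : 0.0176 * (ε * 6.07) ≤ N * Q' :=
    mul_le_mul hp hQ' (by linarith) (by linarith)
  have e2 : N' * Q ≤ 1.822 * (ε * 0.03593) := mul_le_mul hp' hQ hQ0.le (by norm_num)
  have e3 : Q ^ 2 ≤ 0.04 * (ε * 0.03593) := by nlinarith
  linarith

lemma strictMono (ε : ℝ) (he : 1 ≤ ε ∧ ε ≤ 1.05) :
    StrictMonoOn (fun c => Rpert c ε) (Set.Ioo (0.4398 : ℝ) 0.4402) := by
  apply strictMonoOn_of_deriv_pos (convex_Ioo _ _)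
  · intro c hc
    exact (Rpert_deriv c ε hc he).1.continuousAt.continuousWithinAt
  · intro c hc
    rw [interior_Ioo] at hc
    linarith [(Rpert_deriv c ε hc he).2]

lemma contOn (ε : ℝ) (he : 1 ≤ ε ∧ ε ≤ 1.05) {x y : ℝ} (hx : 0.4398 < x) (hy : y < 0.4402) :
    ContinuousOn (fun c => Rpert c ε) (Set.Icc x y) := by
  intro c hc
  exact (Rpert_deriv c ε ⟨hx.trans_le hc.1, hc.2.trans_lt hy⟩ he).1.continuousAt.continuousWithinAt

lemma branch (ε : ℝ) (he : 1 ≤ ε ∧ ε ≤ 1.05) {x y p q : ℝ} (hx : 0.4398 < x) (hxy : x < y)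
    (hy : y < 0.4402) (hp : Rpert x ε = p) (hq : Rpert y ε = q) :
    Set.BijOn (fun c => Rpert c ε) (Set.Icc x y) (Set.Icc p q) ∧
      DifferentiableOn ℝ (fun c => Rpert c ε) (Set.Icc x y) ∧
      ∀ c ∈ Set.Icc x y, 1 < |deriv (fun c => Rpert c ε) c| := by
  have hsub : Set.Icc x y ⊆ Set.Ioo (0.4398 : ℝ) 0.4402 := fun c hc =>
    ⟨hx.trans_le hc.1, hc.2.trans_lt hy⟩
  have hm := (strictMono ε he).mono hsub
  subst hp hq
  refine ⟨⟨?_, hm.injOn, intermediate_value_Icc hxy.le (contOn ε he hx hy)⟩, ?_, ?_⟩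
  · intro c hc
    exact ⟨hm.monotoneOn (Set.left_mem_Icc.2 hxy.le) hc hc.1,
      hm.monotoneOn hc (Set.right_mem_Icc.2 hxy.le) hc.2⟩
  · intro c hc
    exact (Rpert_deriv c ε (hsub hc) he).1.differentiableWithinAt
  · intro c hc
    have := (Rpert_deriv c ε (hsub hc) he).2
    exact lt_of_lt_of_le (by linarith) (le_abs_self _)

lemma fixedPt (ε : ℝ) (he : 1 ≤ ε ∧ ε ≤ 1.05) {x y : ℝ} (hx : 0.4398 < x) (hxy : x < y)
    (hy : y < 0.4402) (hp : Rpert x ε < x) (hq : y < Rpert y ε) :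
    ∃ c, x < c ∧ c < y ∧ Rpert c ε = c := by
  have h := intermediate_value_Ioo hxy.le ((contOn ε he hx hy).sub continuousOn_id)
  obtain ⟨c, hc, h0⟩ := h (show (0 : ℝ) ∈ _ by simp; exact ⟨hp, hq⟩)
  exact ⟨c, hc.1, hc.2, by simpa [sub_eq_zero] using h0⟩

lemma preim (ε : ℝ) (he : 1 ≤ ε ∧ ε ≤ 1.05) {x y v : ℝ} (hx : 0.4398 < x) (hxy : x < y)
    (hy : y < 0.4402) (hp : Rpert x ε < v) (hq : v < Rpert y ε) :
    ∃ c, x < c ∧ c < y ∧ Rpert c ε = v := by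
  obtain ⟨c, hc, h0⟩ := intermediate_value_Ioo hxy.le (contOn ε he hx hy) ⟨hp, hq⟩
  exact ⟨c, hc.1, hc.2, h0⟩

end Horseshoe

/-- An expanding full horseshoe with three branches on parameter space: there are
parameters `ε₀ > ε₁ > ε₂` near `1`, expanding fixed points `c₀* < c₁* < c₂*` of the
corresponding perturbed renormalizations, and pairwise disjoint closed intervals
`A₀ = [c₀*, a₀]`, `A₁ = [a₁, b₁]`, `A₂ = [a₂, c₂*]` inside `[c₀*, c₂*]` each of which
is mapped diffeomorphically onto `[c₀*, c₂*]` by its branch `c ↦ R(c, εᵢ)`, with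
derivative of absolute value greater than `1` throughout. -/
theorem stmt_13 :
    ∃ ε₀ ε₁ ε₂ : ℝ,
      ε₀ ∈ Set.Ioo (1 / 2 : ℝ) (3 / 2) ∧ ε₁ ∈ Set.Ioo (1 / 2 : ℝ) (3 / 2) ∧
      ε₂ ∈ Set.Ioo (1 / 2 : ℝ) (3 / 2) ∧ ε₂ < ε₁ ∧ ε₁ < ε₀ ∧
      ∃ c₀ c₁ c₂ : ℝ,
        c₀ ∈ Set.Ioo (0 : ℝ) (1 / 2) ∧ c₁ ∈ Set.Ioo (0 : ℝ) (1 / 2) ∧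
        c₂ ∈ Set.Ioo (0 : ℝ) (1 / 2) ∧ c₀ < c₁ ∧ c₁ < c₂ ∧
        Rpert c₀ ε₀ = c₀ ∧ Rpert c₁ ε₁ = c₁ ∧ Rpert c₂ ε₂ = c₂ ∧
        2 < deriv (fun c => Rpert c ε₀) c₀ ∧
        2 < deriv (fun c => Rpert c ε₁) c₁ ∧
        2 < deriv (fun c => Rpert c ε₂) c₂ ∧
        ∃ a₀ a₁ b₁ a₂ : ℝ,
          c₀ < a₀ ∧ a₀ < a₁ ∧ a₁ < b₁ ∧ b₁ < a₂ ∧ a₂ < c₂ ∧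
          (Set.BijOn (fun c => Rpert c ε₀) (Set.Icc c₀ a₀) (Set.Icc c₀ c₂) ∧
            DifferentiableOn ℝ (fun c => Rpert c ε₀) (Set.Icc c₀ a₀) ∧
            ∀ c ∈ Set.Icc c₀ a₀, 1 < |deriv (fun c => Rpert c ε₀) c|) ∧
          (Set.BijOn (fun c => Rpert c ε₁) (Set.Icc a₁ b₁) (Set.Icc c₀ c₂) ∧
            DifferentiableOn ℝ (fun c => Rpert c ε₁) (Set.Icc a₁ b₁) ∧
            ∀ c ∈ Set.Icc a₁ b₁, 1 < |deriv (fun c => Rpert c ε₁) c|) ∧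
          (Set.BijOn (fun c => Rpert c ε₂) (Set.Icc a₂ c₂) (Set.Icc c₀ c₂) ∧
            DifferentiableOn ℝ (fun c => Rpert c ε₂) (Set.Icc a₂ c₂) ∧
            ∀ c ∈ Set.Icc a₂ c₂, 1 < |deriv (fun c => Rpert c ε₂) c|) := by
  have he0 : (1 : ℝ) ≤ 1.04 ∧ (1.04 : ℝ) ≤ 1.05 := by norm_num
  have he1 : (1 : ℝ) ≤ 1.03 ∧ (1.03 : ℝ) ≤ 1.05 := by norm_num
  have he2 : (1 : ℝ) ≤ 1.02 ∧ (1.02 : ℝ) ≤ 1.05 := by norm_num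
  obtain ⟨c₀, l0, h0, f0⟩ := Horseshoe.fixedPt 1.04 he0 (x := 0.43989) (y := 0.43991)
    (by norm_num) (by norm_num) (by norm_num)
    (by norm_num [Rpert, uIter, u]) (by norm_num [Rpert, uIter, u])
  obtain ⟨c₁, l1, h1, f1⟩ := Horseshoe.fixedPt 1.03 he1 (x := 0.43998) (y := 0.44)
    (by norm_num) (by norm_num) (by norm_num)
    (by norm_num [Rpert, uIter, u]) (by norm_num [Rpert, uIter, u])
  obtain ⟨c₂, l2, h2, f2⟩ := Horseshoe.fixedPt 1.02 he2 (x := 0.44006) (y := 0.44008)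
    (by norm_num) (by norm_num) (by norm_num)
    (by norm_num [Rpert, uIter, u]) (by norm_num [Rpert, uIter, u])
  have r0 : (0.44008 : ℝ) < Rpert 0.43994 1.04 := by norm_num [Rpert, uIter, u]
  have r1 : Rpert 0.43994 1.03 < (0.43989 : ℝ) := by norm_num [Rpert, uIter, u]
  have r2 : (0.44008 : ℝ) < Rpert 0.44004 1.03 := by norm_num [Rpert, uIter, u]
  have r3 : Rpert 0.44004 1.02 < (0.43989 : ℝ) := by norm_num [Rpert, uIter, u]
  obtain ⟨a₀, p0, q0, g0⟩ := Horseshoe.preim 1.04 he0 (x := c₀) (y := 0.43994) (v := c₂)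
    (by linarith) (by linarith) (by norm_num) (by linarith) (by linarith)
  obtain ⟨a₁, p1, q1, g1⟩ := Horseshoe.preim 1.03 he1 (x := 0.43994) (y := c₁) (v := c₀)
    (by norm_num) (by linarith) (by linarith) (by linarith) (by linarith)
  obtain ⟨b₁, p2, q2, g2⟩ := Horseshoe.preim 1.03 he1 (x := c₁) (y := 0.44004) (v := c₂)
    (by linarith) (by linarith) (by norm_num) (by linarith) (by linarith)
  obtain ⟨a₂, p3, q3, g3⟩ := Horseshoe.preim 1.02 he2 (x := 0.44004) (y := c₂) (v := c₀)
    (by norm_num) (by linarith) (by linarith) (by linarith) (by linarith)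
  refine ⟨1.04, 1.03, 1.02, by norm_num, by norm_num, by norm_num, by norm_num, by norm_num,
    c₀, c₁, c₂, ⟨by linarith, by linarith⟩, ⟨by linarith, by linarith⟩,
    ⟨by linarith, by linarith⟩, by linarith, by linarith, f0, f1, f2,
    (Horseshoe.Rpert_deriv c₀ _ ⟨by linarith, by linarith⟩ he0).2,
    (Horseshoe.Rpert_deriv c₁ _ ⟨by linarith, by linarith⟩ he1).2,
    (Horseshoe.Rpert_deriv c₂ _ ⟨by linarith, by linarith⟩ he2).2,
    a₀, a₁, b₁, a₂, p0, by linarith, by linarith, by linarith, q3,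
    Horseshoe.branch _ he0 (by linarith) p0 (by linarith) f0 g0,
    Horseshoe.branch _ he1 (by linarith) (by linarith) (by linarith) g1 g2,
    Horseshoe.branch _ he2 (by linarith) q3 (by linarith) g3 f2⟩
end

section
/- If c ∈ f_d satisfies R₅(c) = c, then Q₅(c) = Q₂(c)², that is, 1 − u_c⁴(0) = (u_c⁸(0) − u_c³(0))². (The vertical scaling ratio of the period-quintupling renormalization fixed point is the square of the horizontal one.) -/
/-- Period-quintupling scaling function `Q₁(c) = u_c⁵(0)`. -/
noncomputable def Q1 (c : ℝ) : ℝ := uIter c 5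
/-- Period-quintupling scaling function `Q₂(c) = u_c⁸(0) − u_c³(0)`. -/
noncomputable def Q2 (c : ℝ) : ℝ := uIter c 8 - uIter c 3
/-- Period-quintupling scaling function `Q₃(c) = u_c⁶(0) − u_c(0)`. -/
noncomputable def Q3 (c : ℝ) : ℝ := uIter c 6 - uIter c 1
/-- Period-quintupling scaling function `Q₄(c) = u_c²(0) − u_c⁷(0)`. -/
noncomputable def Q4 (c : ℝ) : ℝ := uIter c 2 - uIter c 7
/-- Period-quintupling scaling function `Q₅(c) = 1 − u_c⁴(0)`. -/
noncomputable def Q5 (c : ℝ) : ℝ := 1 - uIter c 4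
/-- Gap function `H_l(c) = u_c³(0) − u_c⁵(0)`. -/
noncomputable def Hl (c : ℝ) : ℝ := uIter c 3 - uIter c 5
/-- Gap function `H₁(c) = u_c(0) − u_c⁸(0)`. -/
noncomputable def H1 (c : ℝ) : ℝ := uIter c 1 - uIter c 8
/-- Gap function `H₂(c) = u_c⁷(0) − u_c⁶(0)`. -/
noncomputable def H2 (c : ℝ) : ℝ := uIter c 7 - uIter c 6
/-- Gap function `H₃(c) = u_c⁴(0) − u_c²(0)`. -/
noncomputable def H3 (c : ℝ) : ℝ := uIter c 4 - uIter c 2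
/-- The period-quintupling renormalization map `R₅(c) = (u_c⁸(0) − c)/Q₂(c)`. -/
noncomputable def R5 (c : ℝ) : ℝ := (uIter c 8 - c) / Q2 c
/-- The quintupling feasible domain `f_d`. -/
def fd : Set ℝ :=
  {c | c ∈ Set.Ioo (0 : ℝ) (1 / 2) ∧ 0 < Q1 c ∧ 0 < Q2 c ∧ 0 < Q3 c ∧ 0 < Q4 c ∧ 0 < Q5 c ∧
    0 < Hl c ∧ 0 < H1 c ∧ 0 < H2 c ∧ 0 < H3 c}

/-- At a fixed point of the period-quintupling renormalization, the vertical
scaling ratio is the square of the horizontal one: `Q₅(c) = Q₂(c)²`. -/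
theorem stmt_15 (c : ℝ) (hc : c ∈ fd) (hfix : R5 c = c) :
    Q5 c = (Q2 c) ^ 2 ∧ 1 - uIter c 4 = (uIter c 8 - uIter c 3) ^ 2 := by
  obtain ⟨⟨h0, h1⟩, -, hQ2, -⟩ := hc
  have hc1 : (1 - c) ≠ 0 := by linarith
  have key : uIter c 8 - c = c * Q2 c := by
    unfold R5 at hfix
    rwa [div_eq_iff hQ2.ne'] at hfix
  have h3 : (uIter c 3 - c) / (1 - c) = - Q2 c := by
    rw [div_eq_iff hc1]
    unfold Q2 at key ⊢
    linarith
  have h4 : uIter c 4 = 1 - ((uIter c 3 - c) / (1 - c)) ^ 2 := by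
    unfold uIter
    rw [Function.iterate_succ_apply' (u c) 3]
    rfl
  have main : Q5 c = (Q2 c) ^ 2 := by
    unfold Q5
    rw [h4, h3]
    ring
  exact ⟨main, main⟩
end

section
/- Let c₅* ∈ f_d satisfy R₅(c₅*) = c₅*. Then R₅ is differentiable at c₅* and |R₅′(c₅*)| > 1; in particular the fixed point c₅* of the period-quintupling renormalization map R₅ is expanding. -/
/-- Rescaled orbit: `Y k l` is the iterate of `y ↦ 1 - l y²` starting at `1 - l`. -/
def Y (l : ℝ) : ℕ → ℝ
  | 0 => 1 - l
  | k + 1 => 1 - l * (Y l k) ^ 2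

/-- Derivative of `Y` in the parameter. -/
def DY (l : ℝ) : ℕ → ℝ
  | 0 => -1
  | k + 1 => -((Y l k) * (Y l k)) - 2 * ((l * Y l k) * DY l k)

lemma hasDerivAt_Y (l : ℝ) (k : ℕ) : HasDerivAt (fun x => Y x k) (DY l k) l := by
  induction k with
  | zero => simpa [Y, DY] using (hasDerivAt_id l).const_sub 1
  | succ k ih =>
    have h := ((hasDerivAt_id l).mul (ih.pow 2)).const_sub 1
    simp only [Y, DY]
    refine h.congr_deriv ?_
    simp
    ring

lemma uIter_eq (c : ℝ) (hc : c ≠ 1) (k : ℕ) :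
    uIter c k = c + (1 - c) * Y (1 / (1 - c)) k := by
  have h1 : 1 - c ≠ 0 := sub_ne_zero.mpr (Ne.symm hc)
  induction k with
  | zero => simp [uIter, Y]; field_simp; ring
  | succ k ih =>
    have : uIter c (k + 1) = u c (uIter c k) := by
      simp [uIter, Function.iterate_succ_apply']
    rw [this, ih]
    simp only [u, Y]
    field_simp
    ring

/-- Scale of the fixed-point interval arithmetic. -/
def SC : ℤ := 2 ^ 30

/-- Membership of a real in a scaled interval. -/
def Mem (x : ℝ) (I : ℤ × ℤ) : Prop := (I.1 : ℝ) ≤ (SC : ℝ) * x ∧ (SC : ℝ) * x ≤ (I.2 : ℝ)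

def imul (x y : ℤ × ℤ) : ℤ × ℤ :=
  (min (min (x.1 * y.1) (x.1 * y.2)) (min (x.2 * y.1) (x.2 * y.2)) / SC,
   max (max (x.1 * y.1) (x.1 * y.2)) (max (x.2 * y.1) (x.2 * y.2)) / SC + 1)

def isq (x : ℤ × ℤ) : ℤ × ℤ :=
  if 0 ≤ x.1 then (x.1 * x.1 / SC, x.2 * x.2 / SC + 1)
  else if x.2 ≤ 0 then (x.2 * x.2 / SC, x.1 * x.1 / SC + 1)
  else (0, max (x.1 * x.1) (x.2 * x.2) / SC + 1)

def isub (x y : ℤ × ℤ) : ℤ × ℤ := (x.1 - y.2, x.2 - y.1)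

def iY (l : ℤ × ℤ) : ℕ → ℤ × ℤ
  | 0 => isub (SC, SC) l
  | k + 1 => isub (SC, SC) (imul l (isq (iY l k)))

lemma SC_pos : (0 : ℝ) < (SC : ℝ) := by norm_num [SC]

lemma div_le_of (a : ℤ) (x : ℝ) (h : (a : ℝ) ≤ SC * (SC * x)) :
    ((a / SC : ℤ) : ℝ) ≤ SC * x := by
  have h1 : SC * (a / SC) ≤ a := Int.mul_ediv_self_le (by norm_num [SC])
  have h2 : (SC : ℝ) * ((a / SC : ℤ) : ℝ) ≤ (a : ℝ) := by exact_mod_cast h1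
  exact le_of_mul_le_mul_left (h2.trans h) SC_pos

lemma le_div_of (a : ℤ) (x : ℝ) (h : SC * (SC * x) ≤ (a : ℝ)) :
    SC * x ≤ ((a / SC + 1 : ℤ) : ℝ) := by
  have h1 : a < SC * (a / SC) + SC := Int.lt_mul_ediv_self_add (by norm_num [SC])
  have h2 : (a : ℝ) ≤ (SC : ℝ) * ((a / SC + 1 : ℤ) : ℝ) := by
    have : a ≤ SC * (a / SC + 1) := by linarith
    exact_mod_cast this
  exact le_of_mul_le_mul_left (h.trans h2) SC_pos

lemma mul_bounds (a b c d x y : ℝ) (h1 : a ≤ x) (h2 : x ≤ b) (h3 : c ≤ y) (h4 : y ≤ d) :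
    min (min (a * c) (a * d)) (min (b * c) (b * d)) ≤ x * y ∧
    x * y ≤ max (max (a * c) (a * d)) (max (b * c) (b * d)) := by
  constructor
  · rcases le_total 0 y with hy | hy
    · have e1 : a * y ≤ x * y := mul_le_mul_of_nonneg_right h1 hy
      rcases le_total 0 a with ha | ha
      · have : a * c ≤ a * y := mul_le_mul_of_nonneg_left h3 ha
        simp only [min_le_iff]; left; left; linarith
      · have : a * d ≤ a * y := mul_le_mul_of_nonpos_left h4 ha
        simp only [min_le_iff]; left; right; linarith
    · have e1 : b * y ≤ x * y := mul_le_mul_of_nonpos_right h2 hy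
      rcases le_total 0 b with ha | ha
      · have : b * c ≤ b * y := mul_le_mul_of_nonneg_left h3 ha
        simp only [min_le_iff]; right; left; linarith
      · have : b * d ≤ b * y := mul_le_mul_of_nonpos_left h4 ha
        simp only [min_le_iff]; right; right; linarith
  · rcases le_total 0 y with hy | hy
    · have e1 : x * y ≤ b * y := mul_le_mul_of_nonneg_right h2 hy
      rcases le_total 0 b with ha | ha
      · have : b * y ≤ b * d := mul_le_mul_of_nonneg_left h4 ha
        simp only [le_max_iff]; right; right; linarith
      · have : b * y ≤ b * c := mul_le_mul_of_nonpos_left h3 ha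
        simp only [le_max_iff]; right; left; linarith
    · have e1 : x * y ≤ a * y := mul_le_mul_of_nonpos_right h1 hy
      rcases le_total 0 a with ha | ha
      · have : a * y ≤ a * d := mul_le_mul_of_nonneg_left h4 ha
        simp only [le_max_iff]; left; right; linarith
      · have : a * y ≤ a * c := mul_le_mul_of_nonpos_left h3 ha
        simp only [le_max_iff]; left; left; linarith

lemma mem_imul {x y : ℝ} {I J : ℤ × ℤ} (hx : Mem x I) (hy : Mem y J) :
    Mem (x * y) (imul I J) := by
  have h := mul_bounds _ _ _ _ _ _ hx.1 hx.2 hy.1 hy.2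
  have e : (SC : ℝ) * x * (SC * y) = SC * (SC * (x * y)) := by ring
  rw [e] at h
  constructor
  · apply div_le_of
    push_cast
    exact h.1
  · apply le_div_of
    push_cast
    exact h.2

lemma mem_isub {x y : ℝ} {I J : ℤ × ℤ} (hx : Mem x I) (hy : Mem y J) :
    Mem (x - y) (isub I J) := by
  obtain ⟨a, b⟩ := hx
  obtain ⟨c, d⟩ := hy
  constructor <;> simp only [isub] <;> push_cast <;> linarith

lemma mem_isq {x : ℝ} {I : ℤ × ℤ} (hx : Mem x I) : Mem (x ^ 2) (isq I) := by
  obtain ⟨a, b⟩ := hx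
  have e : (SC : ℝ) * (SC * x ^ 2) = (SC * x) * (SC * x) := by ring
  unfold isq
  split_ifs with h1 h2
  · have h1' : (0 : ℝ) ≤ I.1 := by exact_mod_cast h1
    constructor
    · apply div_le_of
      rw [e]; push_cast
      exact mul_self_le_mul_self h1' a
    · apply le_div_of
      rw [e]; push_cast
      exact mul_self_le_mul_self (h1'.trans a) b
  · have h2' : (I.2 : ℝ) ≤ 0 := by exact_mod_cast h2
    constructor
    · apply div_le_of
      rw [e]; push_cast
      nlinarith
    · apply le_div_of
      rw [e]; push_cast
      nlinarith
  · constructor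
    · have := SC_pos
      simp only [Int.cast_zero]
      positivity
    · apply le_div_of
      rw [e]; push_cast
      rw [le_max_iff]
      rcases le_total 0 ((SC : ℝ) * x) with h | h
      · right; exact mul_self_le_mul_self h b
      · left; nlinarith

lemma mem_one : Mem 1 (SC, SC) := by constructor <;> simp

lemma mem_iY {l : ℝ} {L : ℤ × ℤ} (hl : Mem l L) (k : ℕ) : Mem (Y l k) (iY L k) := by
  induction k with
  | zero => exact mem_isub mem_one hl
  | succ k ih => exact mem_isub mem_one (mem_imul hl (mem_isq ih))

def iDY (l : ℤ × ℤ) : ℕ → ℤ × ℤ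
  | 0 => (-SC, -SC)
  | k + 1 => isub (isub (0, 0) (imul (iY l k) (iY l k)))
      (imul (2 * SC, 2 * SC) (imul (imul l (iY l k)) (iDY l k)))

lemma mem_iDY {l : ℝ} {L : ℤ × ℤ} (hl : Mem l L) (k : ℕ) : Mem (DY l k) (iDY L k) := by
  induction k with
  | zero => constructor <;> simp [DY, iDY]
  | succ k ih =>
    have hy := mem_iY hl k
    have h0 : Mem 0 (0, 0) := by constructor <;> simp
    have h2 : Mem 2 (2 * SC, 2 * SC) := by constructor <;> simp [mul_comm]
    have := mem_isub (mem_isub h0 (mem_imul hy hy)) (mem_imul h2 (mem_imul (mem_imul hl hy) ih))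
    simp only [DY, iDY]
    simpa using this

/-- Interval chk: some feasibility condition fails, or the fixed-point equation fails,
or the expansion estimate holds. -/
def chk (L : ℤ × ℤ) : Bool :=
  decide (0 ≤ (iY L 3).1) ||
  decide ((iY L 2).2 ≤ (iY L 7).1) ||
  decide ((iY L 3).2 ≤ (iY L 5).1) ||
  decide ((iY L 1).2 ≤ (iY L 8).1) ||
  decide ((iY L 7).2 ≤ (iY L 6).1) ||
  decide (0 < (isub (iY L 8) (imul (isub (SC, SC) L) (iY L 3))).1) ||
  decide ((isub (iY L 8) (imul (isub (SC, SC) L) (iY L 3))).2 < 0) ||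
  decide ((isub (0, 0) (iY L 3)).2 <
    (isub (iDY L 8) (imul (isub (SC, SC) L) (iDY L 3))).1)

def bis : ℕ → ℤ → ℤ → Bool
  | 0, l, h => chk (l, h)
  | n + 1, l, h => chk (l, h) || (bis n l ((l + h) / 2) && bis n ((l + h) / 2) h)

lemma chk_sound {l : ℝ} {L : ℤ × ℤ} (hl : Mem l L) (ht : chk L = true)
    (h3 : Y l 3 < 0) (h27 : Y l 7 < Y l 2) (h35 : Y l 5 < Y l 3) (h18 : Y l 8 < Y l 1)
    (h76 : Y l 6 < Y l 7) (hG : Y l 8 - (1 - l) * Y l 3 = 0) :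
    -Y l 3 < DY l 8 - (1 - l) * DY l 3 := by
  have key : ∀ {x y : ℝ} {I J : ℤ × ℤ}, Mem x I → Mem y J → I.2 ≤ J.1 → x ≤ y := by
    intro x y I J hx hy h
    have : (I.2 : ℝ) ≤ J.1 := by exact_mod_cast h
    exact le_of_mul_le_mul_left (hx.2.trans (this.trans hy.1)) SC_pos
  have key' : ∀ {x y : ℝ} {I J : ℤ × ℤ}, Mem x I → Mem y J → I.2 < J.1 → x < y := by
    intro x y I J hx hy h
    have : (I.2 : ℝ) < J.1 := by exact_mod_cast h
    exact lt_of_mul_lt_mul_left (hx.2.trans_lt (this.trans_le hy.1)) SC_pos.le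
  have h0 : Mem 0 (0, 0) := by constructor <;> simp
  have hGm := mem_isub (mem_iY hl 8) (mem_imul (mem_isub mem_one hl) (mem_iY hl 3))
  have hDm := mem_isub (mem_iDY hl 8) (mem_imul (mem_isub mem_one hl) (mem_iDY hl 3))
  simp only [chk, Bool.or_eq_true, decide_eq_true_eq] at ht
  rcases ht with ((((((ht | ht) | ht) | ht) | ht) | ht) | ht) | ht
  · exact absurd (key h0 (mem_iY hl 3) ht) (not_le.mpr h3)
  · exact absurd (key (mem_iY hl 2) (mem_iY hl 7) ht) (not_le.mpr h27)
  · exact absurd (key (mem_iY hl 3) (mem_iY hl 5) ht) (not_le.mpr h35)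
  · exact absurd (key (mem_iY hl 1) (mem_iY hl 8) ht) (not_le.mpr h18)
  · exact absurd (key (mem_iY hl 7) (mem_iY hl 6) ht) (not_le.mpr h76)
  · exact absurd (key' h0 hGm ht) (by rw [hG]; exact lt_irrefl _)
  · exact absurd (key' hGm h0 ht) (by rw [hG]; exact lt_irrefl _)
  · have := key' (mem_isub h0 (mem_iY hl 3)) hDm ht
    linarith

lemma bis_sound {l : ℝ} (n : ℕ) : ∀ (a b : ℤ), Mem l (a, b) → bis n a b = true →
    ∃ L, Mem l L ∧ chk L = true := by
  induction n with
  | zero => intro a b h ht; exact ⟨_, h, ht⟩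
  | succ n ih =>
    intro a b h ht
    simp only [bis, Bool.or_eq_true, Bool.and_eq_true] at ht
    rcases ht with ht | ⟨h1, h2⟩
    · exact ⟨_, h, ht⟩
    · rcases le_total ((SC : ℝ) * l) (((a + b) / 2 : ℤ) : ℝ) with hm | hm
      · exact ih _ ((a + b) / 2) ⟨h.1, hm⟩ h1
      · exact ih ((a + b) / 2) _ ⟨hm, h.2⟩ h2

/-- The integer endpoints `1.625` and about `1.628` of the exceptional piece. -/
lemma bis_left : bis 10 1073741824 1744830464 = true := by decide +kernel

lemma bis_right : bis 14 1748051689 2147483648 = true := by decide +kernel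

lemma up {x : ℝ} {I : ℤ × ℤ} (h : Mem x I) (n : ℤ) (hn : I.2 * 1000 ≤ n * SC) :
    x * 1000 ≤ n := by
  have h1 : (I.2 : ℝ) * 1000 ≤ n * SC := by exact_mod_cast hn
  have h2 := h.2
  have : (SC : ℝ) * (x * 1000) ≤ SC * n := by linarith
  exact le_of_mul_le_mul_left this SC_pos

lemma lw {x : ℝ} {I : ℤ × ℤ} (h : Mem x I) (n : ℤ) (hn : n * SC ≤ I.1 * 1000) :
    n ≤ x * 1000 := by
  have h1 : n * (SC : ℝ) ≤ I.1 * 1000 := by exact_mod_cast hn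
  have h2 := h.1
  have : (SC : ℝ) * n ≤ SC * (x * 1000) := by linarith
  exact le_of_mul_le_mul_left this SC_pos

set_option maxHeartbeats 800000 in
lemma middle {l : ℝ} (hl : Mem l (1744830464, 1748051689)) (h3 : Y l 3 < 0)
    (hG : Y l 8 - (1 - l) * Y l 3 = 0) : False := by
  have l1 := lw hl 1624 (by decide +kernel)
  have l2 := up hl 1629 (by decide +kernel)
  have a0 := lw (mem_iY hl 0) (-629) (by decide +kernel)
  have a5 := lw (mem_iY hl 5) (-629) (by decide +kernel)
  have a1 := up (mem_iY hl 1) 366 (by decide +kernel)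
  have a6 := up (mem_iY hl 6) 370 (by decide +kernel)
  have a2 := up (mem_iY hl 2) 792 (by decide +kernel)
  have a7 := up (mem_iY hl 7) 792 (by decide +kernel)
  have a4 := up (mem_iY hl 4) 1001 (by decide +kernel)
  have a3 := lw (mem_iY hl 3) (-21) (by decide +kernel)
  have p1 := lw (mem_iY hl 1) 0 (by decide +kernel)
  have p6 := lw (mem_iY hl 6) 0 (by decide +kernel)
  have p2 := lw (mem_iY hl 2) 0 (by decide +kernel)
  have p7 := lw (mem_iY hl 7) 0 (by decide +kernel)
  have p4 := lw (mem_iY hl 4) 0 (by decide +kernel)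
  have p0 := up (mem_iY hl 0) 0 (by decide +kernel)
  have p5 := up (mem_iY hl 5) 0 (by decide +kernel)
  push_cast at l1 l2 a0 a5 a1 a6 a2 a7 a4 a3 p1 p6 p2 p7 p4 p0 p5
  have r0 : (1 : ℝ) = 1 - l * 0 ^ 2 := by ring
  have r1 : Y l 1 = 1 - l * Y l 0 ^ 2 := rfl
  have r2 : Y l 2 = 1 - l * Y l 1 ^ 2 := rfl
  have r3 : Y l 3 = 1 - l * Y l 2 ^ 2 := rfl
  have r4 : Y l 4 = 1 - l * Y l 3 ^ 2 := rfl
  have r5 : Y l 5 = 1 - l * Y l 4 ^ 2 := rfl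
  have r6 : Y l 6 = 1 - l * Y l 5 ^ 2 := rfl
  have r7 : Y l 7 = 1 - l * Y l 6 ^ 2 := rfl
  have r8 : Y l 8 = 1 - l * Y l 7 ^ 2 := rfl
  have z0 : Y l 0 = 1 - l := rfl
  generalize Y l 0 = y0 at *
  generalize Y l 1 = y1 at *
  generalize Y l 2 = y2 at *
  generalize Y l 3 = y3 at *
  generalize Y l 4 = y4 at *
  generalize Y l 5 = y5 at *
  generalize Y l 6 = y6 at *
  generalize Y l 7 = y7 at *
  generalize Y l 8 = y8 at *
  have e4 : 1 - y4 = l * y3 ^ 2 := by linarith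
  have e5 : y5 - y0 = l * ((1 - y4) * (1 + y4)) := by rw [r5, z0]; ring
  have e6 : y6 - y1 = l * ((y5 - y0) * (-y0 - y5)) := by rw [r6, r1]; ring
  have e7 : y2 - y7 = l * ((y6 - y1) * (y6 + y1)) := by rw [r7, r2]; ring
  have e8 : y8 - y3 = l * ((y2 - y7) * (y2 + y7)) := by rw [r8, r3]; ring
  have hl0 : 0 < l := by linarith
  have e9 : -y3 = (y2 - y7) * (y2 + y7) := by
    have : l * (-y3) = l * ((y2 - y7) * (y2 + y7)) := by rw [← e8]; linarith
    exact mul_left_cancel₀ hl0.ne' this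
  have s0 : 0 ≤ y3 ^ 2 := sq_nonneg _
  have w4 : 1 - y4 ≤ 1.629 * y3 ^ 2 := by
    rw [e4]; exact mul_le_mul_of_nonneg_right (by linarith) s0
  have w4' : 0 ≤ 1 - y4 := by rw [e4]; positivity
  have gen : ∀ a s B C : ℝ, 0 ≤ a → 0 ≤ s → a ≤ B * y3 ^ 2 → s ≤ C → 0 ≤ C → 0 ≤ B →
      l * (a * s) ≤ (1.629 * (B * C)) * y3 ^ 2 ∧ 0 ≤ l * (a * s) := by
    intro a s B C ha hs hab hsc hC hB
    have q1 : a * s ≤ (B * y3 ^ 2) * C := mul_le_mul hab hsc hs (by positivity)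
    have q2 : l * (a * s) ≤ 1.629 * ((B * y3 ^ 2) * C) :=
      mul_le_mul (by linarith) q1 (by positivity) (by norm_num)
    exact ⟨by linarith, by positivity⟩
  obtain ⟨w5, w5'⟩ := gen (1 - y4) (1 + y4) _ 2.001 w4' (by linarith) w4 (by linarith)
    (by norm_num) (by norm_num)
  rw [← e5] at w5 w5'
  obtain ⟨w6, w6'⟩ := gen _ (-y0 - y5) _ 1.258 w5' (by linarith) w5 (by linarith)
    (by norm_num) (by norm_num)
  rw [← e6] at w6 w6'
  obtain ⟨w7, w7'⟩ := gen _ (y6 + y1) _ 0.736 w6' (by linarith) w6 (by linarith)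
    (by norm_num) (by norm_num)
  rw [← e7] at w7 w7'
  have f1 : y3 ^ 2 ≤ 0.021 * (-y3) := by
    have : 0 ≤ (y3 + 0.021) * (-y3) := mul_nonneg (by linarith) (by linarith)
    linarith
  have hp : 0 ≤ y2 - y7 := w7'
  have w9 : (y2 - y7) * (y2 + y7) ≤ (y2 - y7) * 1.584 :=
    mul_le_mul_of_nonneg_left (by linarith) hp
  rw [← e9] at w9
  linarith

lemma core {l : ℝ} (hl1 : 1 ≤ l) (hl2 : l ≤ 2)
    (h3 : Y l 3 < 0) (h27 : Y l 7 < Y l 2) (h35 : Y l 5 < Y l 3) (h18 : Y l 8 < Y l 1)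
    (h76 : Y l 6 < Y l 7) (hG : Y l 8 - (1 - l) * Y l 3 = 0) :
    -Y l 3 < DY l 8 - (1 - l) * DY l 3 := by
  have hS : (SC : ℝ) = 1073741824 := by norm_num [SC]
  rcases le_total ((SC : ℝ) * l) 1744830464 with h | h
  · have hm : Mem l (1073741824, 1744830464) := by
      constructor
      · push_cast; rw [hS]; linarith
      · push_cast; exact h
    obtain ⟨L, hL, ht⟩ := bis_sound _ _ _ hm bis_left
    exact chk_sound hL ht h3 h27 h35 h18 h76 hG
  · rcases le_total ((SC : ℝ) * l) 1748051689 with h' | h'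
    · exact (middle ⟨by push_cast; exact h, by push_cast; exact h'⟩ h3 hG).elim
    · have hm : Mem l (1748051689, 2147483648) := by
        constructor
        · push_cast; exact h'
        · push_cast; rw [hS]; linarith
      obtain ⟨L, hL, ht⟩ := bis_sound _ _ _ hm bis_right
      exact chk_sound hL ht h3 h27 h35 h18 h76 hG

lemma R5_eq (c : ℝ) (hc : c < 1) :
    R5 c = Y (1 / (1 - c)) 8 / (Y (1 / (1 - c)) 8 - Y (1 / (1 - c)) 3) := by
  have h1 : 1 - c ≠ 0 := by linarith
  rw [R5, Q2, uIter_eq c hc.ne, uIter_eq c hc.ne,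
    ← mul_div_mul_left (Y (1 / (1 - c)) 8) (Y (1 / (1 - c)) 8 - Y (1 / (1 - c)) 3) h1]
  congr 1 <;> ring

/-- The fixed point of the period-quintupling renormalization map in the
quintupling feasible domain is expanding: `R₅` is differentiable there with
`|R₅′(c₅*)| > 1`. -/
theorem stmt_18 (cstar : ℝ) (hc : cstar ∈ fd) (hfix : R5 cstar = cstar) :
    DifferentiableAt ℝ R5 cstar ∧ 1 < |deriv R5 cstar| := by
  obtain ⟨⟨hc0, hc1⟩, -, hQ2, -, hQ4, -, hHl, hH1, hH2, -⟩ := hc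
  have hlt : cstar < 1 := by linarith
  have h1 : 0 < 1 - cstar := by linarith
  have hfix' := R5_eq cstar hlt
  rw [hfix] at hfix'
  simp only [Q2, Q4, Hl, H1, H2, uIter_eq cstar hlt.ne] at hQ2 hQ4 hHl hH1 hH2
  have hev : R5 =ᶠ[nhds cstar] fun c => Y (1 / (1 - c)) 8 / (Y (1 / (1 - c)) 8 - Y (1 / (1 - c)) 3) := by
    filter_upwards [Iio_mem_nhds hlt] with c hc
    exact R5_eq c hc
  have hL : HasDerivAt (fun c : ℝ => 1 / (1 - c)) ((1 / (1 - cstar)) ^ 2) cstar := by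
    have := ((hasDerivAt_id cstar).const_sub 1).inv h1.ne'
    simp only [one_div]
    refine this.congr_deriv ?_
    simp
  have hl1 : 1 ≤ 1 / (1 - cstar) := by rw [le_div_iff₀ h1]; linarith
  have hl2 : 1 / (1 - cstar) ≤ 2 := by rw [div_le_iff₀ h1]; linarith
  have hcl : cstar = 1 - 1 / (1 / (1 - cstar)) := by rw [one_div_one_div]; ring
  have d8 := (hasDerivAt_Y (1 / (1 - cstar)) 8).comp cstar hL
  have d3 := (hasDerivAt_Y (1 / (1 - cstar)) 3).comp cstar hL
  have p83 : 0 < Y (1 / (1 - cstar)) 8 - Y (1 / (1 - cstar)) 3 :=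
    pos_of_mul_pos_right (a := 1 - cstar) (by linarith) h1.le
  have p27 : 0 < Y (1 / (1 - cstar)) 2 - Y (1 / (1 - cstar)) 7 :=
    pos_of_mul_pos_right (a := 1 - cstar) (by linarith) h1.le
  have p35 : 0 < Y (1 / (1 - cstar)) 3 - Y (1 / (1 - cstar)) 5 :=
    pos_of_mul_pos_right (a := 1 - cstar) (by linarith) h1.le
  have p18 : 0 < Y (1 / (1 - cstar)) 1 - Y (1 / (1 - cstar)) 8 :=
    pos_of_mul_pos_right (a := 1 - cstar) (by linarith) h1.le
  have p76 : 0 < Y (1 / (1 - cstar)) 7 - Y (1 / (1 - cstar)) 6 :=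
    pos_of_mul_pos_right (a := 1 - cstar) (by linarith) h1.le
  have hd := (d8.div (d8.sub d3) p83.ne').congr_of_eventuallyEq hev
  refine ⟨hd.differentiableAt, ?_⟩
  rw [hd.deriv]
  simp only [Function.comp, Pi.sub_apply]
  clear hd d8 d3 hL hev hQ2 hQ4 hHl hH1 hH2
  generalize 1 / (1 - cstar) = l at *
  have hl0 : 0 < l := by linarith
  rw [eq_div_iff p83.ne'] at hfix'
  have hcl' : cstar * l = l - 1 := by rw [hcl]; field_simp
  have hG : Y l 8 - (1 - l) * Y l 3 = 0 := by
    have e : cstar * l * (Y l 8 - Y l 3) = Y l 8 * l := by linear_combination l * hfix'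
    rw [hcl'] at e
    linarith
  have hl1' : 0 < l - 1 := by rw [← hcl']; positivity
  have h3 : Y l 3 < 0 := by
    have : Y l 8 - Y l 3 = l * (-Y l 3) := by linarith
    rw [this] at p83
    have := pos_of_mul_pos_right p83 hl0.le
    linarith
  have key := core hl1 hl2 h3 (by linarith) (by linarith) (by linarith) (by linarith) hG
  have h8 : Y l 8 = (1 - l) * Y l 3 := by linarith
  have hval : (DY l 8 * l ^ 2 * (Y l 8 - Y l 3) - Y l 8 * (DY l 8 * l ^ 2 - DY l 3 * l ^ 2)) /
      (Y l 8 - Y l 3) ^ 2 = (DY l 8 - (1 - l) * DY l 3) / (-Y l 3) := by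
    rw [h8]
    have q1 : (1 - l) * Y l 3 - Y l 3 = -(l * Y l 3) := by ring
    rw [q1]
    have q2 := h3.ne
    field_simp
    ring
  rw [hval]
  exact lt_of_lt_of_le ((one_lt_div (by linarith)).mpr key) (le_abs_self _)
end
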